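/- The element r ∈ D is a ribbon element for (D, R): r is invertible, central (r x = x r for all x ∈ D), and satisfies r² = u·S(u), S(r) = r, ε(r) = 1, and Δ(r) = (R₂₁R)⁻¹·(r ⊗ r), where R₂₁ = τ(R) with τ the flip of tensor factors and u = Σ_i S(β_i)α_i for R = Σ_i α_i ⊗ β_i. -/

import Mathlib

open scoped TensorProduct
open Finset

noncomputable section

namespace LogHennings

/-- `q = exp(iπ/p)`. -/
def qq (p : ℕ) : ℂ := Complex.exp ((Real.pi : ℂ) * Complex.I / (p : ℂ))

/-- `q^{1/2} = exp(iπ/(2p))`. -/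
def qh (p : ℕ) : ℂ := Complex.exp ((Real.pi : ℂ) * Complex.I / (2 * (p : ℂ)))

/-- quantum integer `[m] = (q^m - q^{-m})/(q - q⁻¹)`. -/
def qnum (p m : ℕ) : ℂ := ((qq p) ^ m - (qq p)⁻¹ ^ m) / (qq p - (qq p)⁻¹)

/-- quantum factorial `[m]! = [m][m-1]⋯[1]`. -/
def qfac (p : ℕ) : ℕ → ℂ
  | 0 => 1
  | m + 1 => qnum p (m + 1) * qfac p m

/-- Generators of the restricted quantum group `U`. -/
inductive UGen | E | F | K | Kinv

abbrev FU := FreeAlgebra ℂ UGen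

def fE : FU := FreeAlgebra.ι ℂ UGen.E
def fF : FU := FreeAlgebra.ι ℂ UGen.F
def fK : FU := FreeAlgebra.ι ℂ UGen.K
def fKinv : FU := FreeAlgebra.ι ℂ UGen.Kinv

/-- Defining relations of the restricted quantum group `U`. -/
inductive URel (p : ℕ) : FU → FU → Prop
  | Epow : URel p (fE ^ p) 0
  | Fpow : URel p (fF ^ p) 0
  | Kpow : URel p (fK ^ (2 * p)) 1
  | KKinv : URel p (fK * fKinv) 1
  | KinvK : URel p (fKinv * fK) 1
  | KE : URel p (fK * fE * fKinv) ((qq p) ^ 2 • fE)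
  | KF : URel p (fK * fF * fKinv) (((qq p) ^ 2)⁻¹ • fF)
  | EF : URel p (fE * fF - fF * fE) ((qq p - (qq p)⁻¹)⁻¹ • (fK - fKinv))

/-- The restricted quantum group `U = \bar U_q(sl2)`. -/
abbrev Uq (p : ℕ) := RingQuot (URel p)

def UE (p : ℕ) : Uq p := RingQuot.mkAlgHom ℂ (URel p) fE
def UF (p : ℕ) : Uq p := RingQuot.mkAlgHom ℂ (URel p) fF
def UK (p : ℕ) : Uq p := RingQuot.mkAlgHom ℂ (URel p) fK
def UKinv (p : ℕ) : Uq p := RingQuot.mkAlgHom ℂ (URel p) fKinv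

/-- Generators of the braided extension `D`. -/
inductive DGen | e | phi | k | kinv

abbrev FD := FreeAlgebra ℂ DGen

def fe : FD := FreeAlgebra.ι ℂ DGen.e
def fphi : FD := FreeAlgebra.ι ℂ DGen.phi
def fk : FD := FreeAlgebra.ι ℂ DGen.k
def fkinv : FD := FreeAlgebra.ι ℂ DGen.kinv

/-- Defining relations of `D`. -/
inductive DRel (p : ℕ) : FD → FD → Prop
  | epow : DRel p (fe ^ p) 0
  | phipow : DRel p (fphi ^ p) 0
  | kpow : DRel p (fk ^ (4 * p)) 1
  | kkinv : DRel p (fk * fkinv) 1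
  | kinvk : DRel p (fkinv * fk) 1
  | ke : DRel p (fk * fe * fkinv) (qq p • fe)
  | kphi : DRel p (fk * fphi * fkinv) ((qq p)⁻¹ • fphi)
  | ephi : DRel p (fe * fphi - fphi * fe)
      ((qq p - (qq p)⁻¹)⁻¹ • (fk ^ 2 - fkinv ^ 2))

/-- The braided extension `D` of `U`. -/
abbrev Dq (p : ℕ) := RingQuot (DRel p)

def De (p : ℕ) : Dq p := RingQuot.mkAlgHom ℂ (DRel p) fe
def Dphi (p : ℕ) : Dq p := RingQuot.mkAlgHom ℂ (DRel p) fphi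
def Dk (p : ℕ) : Dq p := RingQuot.mkAlgHom ℂ (DRel p) fk
def Dkinv (p : ℕ) : Dq p := RingQuot.mkAlgHom ℂ (DRel p) fkinv

/-- The `R`-matrix of `D`. -/
def Rmat (p : ℕ) : Dq p ⊗[ℂ] Dq p :=
  ((4 * (p : ℂ))⁻¹) •
    ∑ m ∈ range p, ∑ n ∈ range (4 * p), ∑ j ∈ range (4 * p),
      (((qq p - (qq p)⁻¹) ^ m / qfac p m) *
          (qh p) ^ ((m : ℤ) * ((m : ℤ) - 1) + 2 * (m : ℤ) * ((n : ℤ) - (j : ℤ))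
            - (n : ℤ) * (j : ℤ))) •
        ((De p ^ m * Dk p ^ n) ⊗ₜ[ℂ] (Dphi p ^ m * Dk p ^ j))

/-- `R₂₁ = τ(R)`. -/
def R21 (p : ℕ) : Dq p ⊗[ℂ] Dq p := TensorProduct.comm ℂ (Dq p) (Dq p) (Rmat p)

/-- The monodromy `M = R₂₁ R`. -/
def Mmat (p : ℕ) : Dq p ⊗[ℂ] Dq p := R21 p * Rmat p

/-- The ribbon element `r ∈ D`. -/
def rib (p : ℕ) : Dq p :=
  ((1 - Complex.I) / (2 * (Real.sqrt p : ℂ))) •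
    ∑ m ∈ range p, ∑ j ∈ range (2 * p),
      (((qq p - (qq p)⁻¹) ^ m / qfac p m) *
          (qh p) ^ (-(m : ℤ) + 2 * (m : ℤ) * (j : ℤ) + ((j : ℤ) + (p : ℤ) + 1) ^ 2)) •
        (Dphi p ^ m * De p ^ m * Dk p ^ (2 * j))

/-- The Drinfeld element `u = Σ S(β_i) α_i` for `R = Σ α_i ⊗ β_i`,
depending on a choice of antipode `S`. -/
def drinfeldU (p : ℕ) (S : Dq p →ₗ[ℂ] Dq p) : Dq p :=
  LinearMap.mul' ℂ (Dq p) (TensorProduct.map S LinearMap.id (R21 p))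

/-- `Δ` takes the prescribed values on the generators of `U`. -/
def IsDeltaU (p : ℕ) (Δ : Uq p →ₐ[ℂ] Uq p ⊗[ℂ] Uq p) : Prop :=
  Δ (UE p) = 1 ⊗ₜ[ℂ] UE p + UE p ⊗ₜ[ℂ] UK p ∧
  Δ (UF p) = UKinv p ⊗ₜ[ℂ] UF p + UF p ⊗ₜ[ℂ] 1 ∧
  Δ (UK p) = UK p ⊗ₜ[ℂ] UK p ∧
  Δ (UKinv p) = UKinv p ⊗ₜ[ℂ] UKinv p

/-- `ε` takes the prescribed values on the generators of `U`. -/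
def IsCounitU (p : ℕ) (ε : Uq p →ₐ[ℂ] ℂ) : Prop :=
  ε (UE p) = 0 ∧ ε (UF p) = 0 ∧ ε (UK p) = 1 ∧ ε (UKinv p) = 1

/-- `S` is an algebra anti-homomorphism taking the prescribed values on the
generators of `U`. -/
def IsAntipodeU (p : ℕ) (S : Uq p →ₗ[ℂ] Uq p) : Prop :=
  S 1 = 1 ∧ (∀ x y, S (x * y) = S y * S x) ∧
  S (UE p) = -(UE p * UKinv p) ∧ S (UF p) = -(UK p * UF p) ∧
  S (UK p) = UKinv p ∧ S (UKinv p) = UK p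

/-- `Δ` takes the prescribed values on the generators of `D`. -/
def IsDeltaD (p : ℕ) (Δ : Dq p →ₐ[ℂ] Dq p ⊗[ℂ] Dq p) : Prop :=
  Δ (De p) = 1 ⊗ₜ[ℂ] De p + De p ⊗ₜ[ℂ] (Dk p ^ 2) ∧
  Δ (Dphi p) = (Dkinv p ^ 2) ⊗ₜ[ℂ] Dphi p + Dphi p ⊗ₜ[ℂ] 1 ∧
  Δ (Dk p) = Dk p ⊗ₜ[ℂ] Dk p ∧
  Δ (Dkinv p) = Dkinv p ⊗ₜ[ℂ] Dkinv p

/-- `ε` takes the prescribed values on the generators of `D`. -/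
def IsCounitD (p : ℕ) (ε : Dq p →ₐ[ℂ] ℂ) : Prop :=
  ε (De p) = 0 ∧ ε (Dphi p) = 0 ∧ ε (Dk p) = 1 ∧ ε (Dkinv p) = 1

/-- `S` is an algebra anti-homomorphism taking the prescribed values on the
generators of `D`. -/
def IsAntipodeD (p : ℕ) (S : Dq p →ₗ[ℂ] Dq p) : Prop :=
  S 1 = 1 ∧ (∀ x y, S (x * y) = S y * S x) ∧
  S (De p) = -(De p * Dkinv p ^ 2) ∧ S (Dphi p) = -(Dk p ^ 2 * Dphi p) ∧
  S (Dk p) = Dkinv p ∧ S (Dkinv p) = Dk p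

/-- `ι` takes the prescribed values `E ↦ e`, `F ↦ φ`, `K^{±1} ↦ k^{±2}`. -/
def IsIota (p : ℕ) (ι : Uq p →ₐ[ℂ] Dq p) : Prop :=
  ι (UE p) = De p ∧ ι (UF p) = Dphi p ∧ ι (UK p) = Dk p ^ 2 ∧
  ι (UKinv p) = Dkinv p ^ 2

/-- `μ` takes the prescribed values on the PBW basis of `U`. -/
def IsMu (p : ℕ) (μ : Uq p →ₗ[ℂ] ℂ) : Prop :=
  ∀ m n l : ℕ, m < p → n < p → l < 2 * p →
    μ (UE p ^ m * UF p ^ n * UK p ^ l) =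
      if m = p - 1 ∧ n = p - 1 ∧ l = p + 1 then
        -((Real.sqrt (2 / (p : ℝ)) : ℂ)) * (qfac p (p - 1)) ^ 2
      else 0

variable {A : Type*} [Ring A] [Algebra ℂ A]

/-- Coassociativity of a comultiplication. -/
def Coassoc (Δ : A →ₐ[ℂ] A ⊗[ℂ] A) : Prop :=
  ∀ x, TensorProduct.assoc ℂ A A A
      (TensorProduct.map Δ.toLinearMap LinearMap.id (Δ x)) =
    TensorProduct.map LinearMap.id Δ.toLinearMap (Δ x)

/-- The counit axiom. -/
def CounitAxiom (Δ : A →ₐ[ℂ] A ⊗[ℂ] A) (ε : A →ₐ[ℂ] ℂ) : Prop :=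
  (∀ x, TensorProduct.lid ℂ A
      (TensorProduct.map ε.toLinearMap LinearMap.id (Δ x)) = x) ∧
  (∀ x, TensorProduct.rid ℂ A
      (TensorProduct.map LinearMap.id ε.toLinearMap (Δ x)) = x)

/-- The antipode axiom. -/
def AntipodeAxiom (Δ : A →ₐ[ℂ] A ⊗[ℂ] A) (ε : A →ₐ[ℂ] ℂ)
    (S : A →ₗ[ℂ] A) : Prop :=
  (∀ x, LinearMap.mul' ℂ A (TensorProduct.map S LinearMap.id (Δ x)) = ε x • 1) ∧
  (∀ x, LinearMap.mul' ℂ A (TensorProduct.map LinearMap.id S (Δ x)) = ε x • 1)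

/-- `x ↦ x ⊗ 1`. -/
def e1 (p : ℕ) : Dq p →ₗ[ℂ] Dq p ⊗[ℂ] Dq p :=
  (TensorProduct.mk ℂ (Dq p) (Dq p)).flip 1

/-- `x ↦ 1 ⊗ x`. -/
def e2 (p : ℕ) : Dq p →ₗ[ℂ] Dq p ⊗[ℂ] Dq p :=
  TensorProduct.mk ℂ (Dq p) (Dq p) 1

/-- The balancing element `g = K^{p+1}`. -/
def gU (p : ℕ) : Uq p := UK p ^ (p + 1)

/-- The span of commutators `[U,U]`. -/
def commSpan (p : ℕ) : Submodule ℂ (Uq p) :=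
  Submodule.span ℂ {z : Uq p | ∃ x y : Uq p, z = x * y - y * x}

end LogHennings

set_option linter.unusedSectionVars false
namespace LogHennings

/-! ### The quadratic Gauss sum modulo `4p`, via theta functions -/

lemma theta_split (N : ℕ) [NeZero N] (ε : ℝ) (hε : 0 < ε) :
    jacobiTheta (2 / (N : ℂ) + Complex.I * ε) =
      ∑ j : Fin N, Complex.exp (2 * Real.pi * Complex.I * (j : ℕ) ^ 2 / N) *
        (HurwitzZeta.evenKernel (((j : ℕ) / (N : ℝ) : ℝ) : UnitAddCircle) ((N : ℝ) ^ 2 * ε) : ℂ) := by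
  have hN : (N : ℂ) ≠ 0 := by exact_mod_cast NeZero.ne N
  have hNr : (N : ℝ) ≠ 0 := by exact_mod_cast NeZero.ne N
  have him : 0 < (2 / (N : ℂ) + Complex.I * ε).im := by
    have : (2 / (N : ℂ)).im = 0 := by
      have : (2 / (N : ℂ)) = ((2 / (N : ℝ) : ℝ) : ℂ) := by push_cast; rfl
      rw [this, Complex.ofReal_im]
    simp [this, hε]
  have hs := hasSum_jacobiTheta₂_term 0 him
  rw [← jacobiTheta_eq_jacobiTheta₂] at hs
  rw [← hs.tsum_eq]
  have hsum := hs.summable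
  rw [← ((Equiv.prodComm (Fin N) ℤ).trans (Int.divModEquiv N).symm).tsum_eq]
  rw [show (∑' c : Fin N × ℤ, jacobiTheta₂_term (((Equiv.prodComm (Fin N) ℤ).trans
    (Int.divModEquiv N).symm) c) 0 (2 / (N : ℂ) + Complex.I * ε)) = ∑' c, ((fun n =>
    jacobiTheta₂_term n 0 (2 / (N : ℂ) + Complex.I * ε)) ∘ ((Equiv.prodComm (Fin N) ℤ).trans
    (Int.divModEquiv N).symm)) c from rfl,
    Summable.tsum_prod (((Equiv.prodComm (Fin N) ℤ).trans
    (Int.divModEquiv N).symm).summable_iff.mpr hsum), tsum_fintype]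
  refine Finset.sum_congr rfl fun j _ => ?_
  have hk := Complex.hasSum_ofReal.mpr
    (HurwitzZeta.hasSum_int_evenKernel ((j : ℕ) / (N : ℝ)) (t := (N : ℝ) ^ 2 * ε)
      (by positivity))
  rw [← (hk.mul_left (Complex.exp (2 * Real.pi * Complex.I * (j : ℕ) ^ 2 / N))).tsum_eq]
  refine tsum_congr fun m => ?_
  simp only [Function.comp_apply, Equiv.trans_apply, Equiv.prodComm_apply, Prod.swap_prod_mk,
    Int.divModEquiv_symm_apply, jacobiTheta₂_term]
  have h1 : Complex.exp (2 * Real.pi * Complex.I * (j : ℕ) ^ 2 / N) =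
      Complex.exp (2 * Real.pi * Complex.I * (j : ℕ) ^ 2 / N +
        ((N * m ^ 2 + 2 * m * (j : ℕ) : ℤ) : ℂ) * (2 * Real.pi * Complex.I)) := by
    rw [Complex.exp_add, Complex.exp_int_mul_two_pi_mul_I, mul_one]
  rw [h1, Complex.ofReal_exp, ← Complex.exp_add]
  congr 1
  push_cast
  field_simp
  have := Complex.I_sq
  ring_nf
  simp only [this]
  ring

lemma tendsto_evenKernel_small (N : ℕ) [NeZero N] (a : UnitAddCircle) :
    Filter.Tendsto (fun ε : ℝ => Real.sqrt ε * HurwitzZeta.evenKernel a ((N : ℝ) ^ 2 * ε))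
      (nhdsWithin 0 (Set.Ioi 0)) (nhds (1 / N)) := by
  have hNr : (0 : ℝ) < N := by exact_mod_cast Nat.pos_of_ne_zero (NeZero.ne N)
  obtain ⟨c, hc, hO⟩ := HurwitzZeta.isBigO_atTop_cosKernel_sub a
  have h0 : Filter.Tendsto (fun x : ℝ => Real.exp (-c * x)) Filter.atTop (nhds 0) := by
    apply Real.tendsto_exp_atBot.comp
    exact Filter.tendsto_id.const_mul_atTop_of_neg (by linarith)
  have h1 := hO.trans_tendsto h0
  have h2 : Filter.Tendsto (HurwitzZeta.cosKernel a) Filter.atTop (nhds 1) := by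
    simpa using h1.add_const 1
  have h3 : Filter.Tendsto (fun ε : ℝ => 1 / ((N : ℝ) ^ 2 * ε)) (nhdsWithin 0 (Set.Ioi 0))
      Filter.atTop := by
    have := (tendsto_inv_nhdsGT_zero (𝕜 := ℝ)).const_mul_atTop
      (show (0 : ℝ) < 1 / (N : ℝ) ^ 2 by positivity)
    refine this.congr fun x => ?_
    rw [one_div, one_div, mul_inv]
  have h4 := (h2.comp h3).const_mul (1 / (N : ℝ))
  rw [mul_one] at h4
  refine h4.congr' ?_
  filter_upwards [self_mem_nhdsWithin] with ε hε
  have hε' : (0 : ℝ) < ε := hε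
  rw [HurwitzZeta.evenKernel_functional_equation, ← Real.sqrt_eq_rpow,
    Real.sqrt_mul (by positivity), Real.sqrt_sq hNr.le]
  have := Real.sqrt_pos.mpr hε'
  simp only [Function.comp]
  field_simp

lemma jacobiTheta_sub_even (n : ℕ) (τ : ℂ) : jacobiTheta (τ - 2 * n) = jacobiTheta τ := by
  induction n with
  | zero => simp
  | succ n ih =>
    rw [← ih, ← jacobiTheta_two_add (τ - 2 * ((n + 1 : ℕ) : ℂ))]
    congr 1; push_cast; ring

lemma jacobiTheta_S (τ : ℂ) :
    jacobiTheta τ = 1 / (-Complex.I * τ) ^ (1 / 2 : ℂ) * jacobiTheta (-1 / τ) := by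
  rw [jacobiTheta_eq_jacobiTheta₂, jacobiTheta₂_functional_equation, jacobiTheta_eq_jacobiTheta₂]
  simp

lemma real_mul_cpow' {r : ℝ} (hr : 0 < r) {z : ℂ} (hz : z ≠ 0) (s : ℂ) :
    ((r : ℂ) * z) ^ s = (r : ℂ) ^ s * z ^ s := by
  have hrc : (r : ℂ) ≠ 0 := by exact_mod_cast hr.ne'
  rw [Complex.cpow_def_of_ne_zero (mul_ne_zero hrc hz), Complex.cpow_def_of_ne_zero hrc,
    Complex.cpow_def_of_ne_zero hz, Complex.log_ofReal_mul hr hz, ← Complex.exp_add,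
    Complex.ofReal_log hr.le, add_mul]

lemma theta_other (p : ℕ) (hp : 0 < p) (ε : ℝ) (hε : 0 < ε) :
    (Real.sqrt ε : ℂ) * jacobiTheta (2 / ((4 * p : ℕ) : ℂ) + Complex.I * ε) =
      1 / (-Complex.I * (2 / ((4 * p : ℕ) : ℂ) + Complex.I * ε)) ^ (1 / 2 : ℂ) *
      (1 / (2 * p / (2 / ((4 * p : ℕ) : ℂ) + Complex.I * ε)) ^ (1 / 2 : ℂ)) *
      jacobiTheta (-1 / (2 * p) + Complex.I * ((1 / (4 * p ^ 2) * ε⁻¹ : ℝ) : ℂ)) := by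
  have hpc : (p : ℂ) ≠ 0 := by exact_mod_cast hp.ne'
  have hεc : (ε : ℂ) ≠ 0 := by exact_mod_cast hε.ne'
  set τ : ℂ := 2 / ((4 * p : ℕ) : ℂ) + Complex.I * ε with hτ
  have hτ0 : τ ≠ 0 := by
    intro h
    have := congrArg Complex.im h
    have h2 : (2 / ((4 * p : ℕ) : ℂ)).im = 0 := by
      have : (2 / ((4 * p : ℕ) : ℂ)) = ((2 / ((4 * p : ℕ) : ℝ) : ℝ) : ℂ) := by push_cast; rfl
      rw [this, Complex.ofReal_im]
    rw [hτ, Complex.add_im, h2] at this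
    simp at this
    exact hε.ne' this
  have hI := Complex.I_sq
  rw [jacobiTheta_S τ]
  have e1 : -1 / τ = (2 * p * (Complex.I * ε) / τ) - 2 * (p : ℕ) := by
    field_simp
    rw [hτ]; push_cast; field_simp; ring
  rw [e1, jacobiTheta_sub_even, jacobiTheta_S (2 * p * (Complex.I * ε) / τ)]
  have e2 : -1 / (2 * p * (Complex.I * ε) / τ) =
      -1 / (2 * p) + Complex.I * ((1 / (4 * p ^ 2) * ε⁻¹ : ℝ) : ℂ) := by
    rw [hτ]; push_cast; field_simp
    linear_combination (-2) * hI
  have e3 : -Complex.I * (2 * p * (Complex.I * ε) / τ) = (ε : ℂ) * (2 * p / τ) := by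
    field_simp
    linear_combination (-1) * hI
  rw [e2, e3, real_mul_cpow' hε (div_ne_zero (mul_ne_zero two_ne_zero hpc) hτ0)]
  have e4 : (ε : ℂ) ^ (1 / 2 : ℂ) = (Real.sqrt ε : ℂ) := by
    rw [Real.sqrt_eq_rpow, Complex.ofReal_cpow hε.le]; push_cast; rfl
  rw [e4]
  have : (Real.sqrt ε : ℂ) ≠ 0 := by exact_mod_cast (Real.sqrt_pos.mpr hε).ne'
  field_simp


lemma gauss_aux (p : ℕ) (hp : 0 < p) [NeZero (4 * p)] :
    ∑ j : Fin (4 * p), Complex.exp (2 * Real.pi * Complex.I * (j : ℕ) ^ 2 / ((4 * p : ℕ) : ℂ)) =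
      2 * (1 + Complex.I) * (Real.sqrt p : ℂ) := by
  have hpc : (p : ℂ) ≠ 0 := by exact_mod_cast hp.ne'
  have hpr : (0 : ℝ) < p := by exact_mod_cast hp
  set N := 4 * p with hN
  set G := ∑ j : Fin N, Complex.exp (2 * Real.pi * Complex.I * (j : ℕ) ^ 2 / (N : ℂ)) with hG
  -- first limit
  have l1 : Filter.Tendsto (fun ε : ℝ => (Real.sqrt ε : ℂ) *
      jacobiTheta (2 / (N : ℂ) + Complex.I * ε)) (nhdsWithin 0 (Set.Ioi 0))
      (nhds (G * (1 / N))) := by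
    have : Filter.Tendsto (fun ε : ℝ => ∑ j : Fin N,
        Complex.exp (2 * Real.pi * Complex.I * (j : ℕ) ^ 2 / (N : ℂ)) *
        ((Real.sqrt ε * HurwitzZeta.evenKernel (((j : ℕ) / (N : ℝ) : ℝ) : UnitAddCircle)
          ((N : ℝ) ^ 2 * ε) : ℝ) : ℂ)) (nhdsWithin 0 (Set.Ioi 0)) (nhds (G * (1 / N))) := by
      rw [hG, Finset.sum_mul]
      refine tendsto_finsetSum _ fun j _ => ?_
      refine Filter.Tendsto.const_mul _ ?_
      have := (Complex.continuous_ofReal.tendsto _).comp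
        (tendsto_evenKernel_small N (((j : ℕ) / (N : ℝ) : ℝ) : UnitAddCircle))
      simpa [Function.comp_def] using this
    refine this.congr' ?_
    filter_upwards [self_mem_nhdsWithin] with ε hε
    rw [theta_split N ε hε, Finset.mul_sum]
    refine Finset.sum_congr rfl fun j _ => ?_
    push_cast; ring
  -- second limit
  have hid : Filter.Tendsto (fun ε : ℝ => (2 / (N : ℂ) + Complex.I * ε))
      (nhdsWithin 0 (Set.Ioi 0)) (nhds (2 / (N : ℂ))) := by
    have : Continuous (fun ε : ℝ => (2 / (N : ℂ) + Complex.I * ε)) := by fun_prop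
    have h := this.tendsto 0
    simp only [Complex.ofReal_zero, mul_zero, add_zero] at h
    exact h.mono_left nhdsWithin_le_nhds
  have hNc : (2 / (N : ℂ)) ≠ 0 := by
    rw [hN]; push_cast; simp [hpc]
  have l2 : Filter.Tendsto (fun ε : ℝ => (Real.sqrt ε : ℂ) *
      jacobiTheta (2 / (N : ℂ) + Complex.I * ε)) (nhdsWithin 0 (Set.Ioi 0))
      (nhds (1 / (-Complex.I * (2 / (N : ℂ))) ^ (1 / 2 : ℂ) *
        (1 / (2 * p / (2 / (N : ℂ))) ^ (1 / 2 : ℂ)) * 1)) := by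
    have hT : Filter.Tendsto (fun ε : ℝ => jacobiTheta (-1 / (2 * p) +
        Complex.I * ((1 / (4 * p ^ 2) * ε⁻¹ : ℝ) : ℂ))) (nhdsWithin 0 (Set.Ioi 0)) (nhds 1) := by
      have h0 : Filter.Tendsto (fun τ : ℂ => Real.exp (-Real.pi * τ.im))
          (Filter.comap Complex.im Filter.atTop) (nhds 0) := by
        apply Real.tendsto_exp_atBot.comp
        exact Filter.Tendsto.const_mul_atTop_of_neg (by linarith [Real.pi_pos])
          Filter.tendsto_comap
      have h1 := isBigO_at_im_infty_jacobiTheta_sub_one.trans_tendsto h0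
      have h2 : Filter.Tendsto jacobiTheta (Filter.comap Complex.im Filter.atTop) (nhds 1) := by
        simpa using h1.add_const 1
      refine h2.comp ?_
      rw [Filter.tendsto_comap_iff]
      have := (tendsto_inv_nhdsGT_zero (𝕜 := ℝ)).const_mul_atTop
        (show (0 : ℝ) < 1 / (4 * (p : ℝ) ^ 2) by positivity)
      refine this.congr fun x => ?_
      have h2 : (-1 / (2 * (p : ℂ))).im = 0 := by
        have : (-1 / (2 * (p : ℂ))) = ((-1 / (2 * (p : ℝ)) : ℝ) : ℂ) := by push_cast; rfl
        rw [this, Complex.ofReal_im]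
      rw [Function.comp_apply, Complex.add_im, h2, Complex.mul_im, Complex.ofReal_re,
        Complex.ofReal_im]
      simp
    have hA : Filter.Tendsto (fun ε : ℝ => 1 / (-Complex.I * (2 / (N : ℂ) + Complex.I * ε)) ^
        (1 / 2 : ℂ)) (nhdsWithin 0 (Set.Ioi 0))
        (nhds (1 / (-Complex.I * (2 / (N : ℂ))) ^ (1 / 2 : ℂ))) := by
      have hsl : -Complex.I * (2 / (N : ℂ)) ∈ Complex.slitPlane := by
        right
        rw [hN, show -Complex.I * (2 / ((4 * p : ℕ) : ℂ)) =
          ((-2 / (4 * p) : ℝ) : ℂ) * Complex.I by push_cast; ring]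
        rw [Complex.im_ofReal_mul, Complex.I_im, mul_one]
        exact div_ne_zero (by norm_num) (by positivity)
      refine Filter.Tendsto.div tendsto_const_nhds ?_ ?_
      · exact (hid.const_mul _).cpow tendsto_const_nhds hsl
      · rw [Ne, Complex.cpow_eq_zero_iff]
        simp [hNc]
    have hB : Filter.Tendsto (fun ε : ℝ => 1 / (2 * p / (2 / (N : ℂ) + Complex.I * ε)) ^
        (1 / 2 : ℂ)) (nhdsWithin 0 (Set.Ioi 0))
        (nhds (1 / (2 * p / (2 / (N : ℂ))) ^ (1 / 2 : ℂ))) := by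
      have hv : 2 * p / (2 / (N : ℂ)) = ((4 * p ^ 2 : ℝ) : ℂ) := by
        rw [hN]; push_cast; field_simp
      have hsl : 2 * p / (2 / (N : ℂ)) ∈ Complex.slitPlane := by
        left
        rw [hv, Complex.ofReal_re]; positivity
      refine Filter.Tendsto.div tendsto_const_nhds ?_ ?_
      · exact (Filter.Tendsto.div tendsto_const_nhds hid hNc).cpow tendsto_const_nhds hsl
      · rw [Ne, Complex.cpow_eq_zero_iff]
        rintro ⟨h, -⟩
        exact Complex.slitPlane_ne_zero hsl h
    refine ((hA.mul hB).mul hT).congr' ?_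
    filter_upwards [self_mem_nhdsWithin] with ε hε
    exact (theta_other p hp ε hε).symm
  have key := tendsto_nhds_unique l1 l2
  have hNp : (N : ℂ) = 4 * p := by rw [hN]; push_cast; ring
  have v1 : (2 * p / (2 / (N : ℂ))) ^ (1 / 2 : ℂ) = 2 * p := by
    have hv : 2 * p / (2 / (N : ℂ)) = ((2 * p : ℂ)) ^ (2 : ℕ) := by
      rw [hNp]; field_simp; ring
    rw [hv, show ((1 / 2 : ℂ)) = ((2 : ℕ) : ℂ)⁻¹ by push_cast; ring]
    have : ((2 * p : ℂ)) ^ (2 : ℕ) = (((2 * p : ℝ) ^ (2 : ℕ) : ℝ) : ℂ) := by push_cast; rfl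
    rw [this, show (((2 : ℕ) : ℂ)⁻¹) = (((2 : ℝ)⁻¹ : ℝ) : ℂ) by push_cast; rfl,
      ← Complex.ofReal_cpow (by positivity)]
    rw [show (2 : ℝ)⁻¹ = 1 / 2 by norm_num, ← Real.sqrt_eq_rpow, Real.sqrt_sq (by positivity)]
    push_cast; rfl
  have hsp : (Real.sqrt p : ℂ) ≠ 0 := by exact_mod_cast (Real.sqrt_pos.mpr hpr).ne'
  have hsq : (Real.sqrt p : ℂ) ^ 2 = p := by exact_mod_cast Real.sq_sqrt hpr.le
  have v2 : (-Complex.I * (2 / (N : ℂ))) ^ (1 / 2 : ℂ) =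
      (1 - Complex.I) / (2 * (Real.sqrt p : ℂ)) := by
    have hv : -Complex.I * (2 / (N : ℂ)) = ((1 - Complex.I) / (2 * (Real.sqrt p : ℂ))) ^ (2 : ℕ) := by
      rw [hNp, div_pow, mul_pow, hsq]
      field_simp
      ring_nf
      rw [Complex.I_sq]; ring
    rw [hv, show ((1 / 2 : ℂ)) = ((2 : ℕ) : ℂ)⁻¹ by push_cast; ring]
    have harg : ((1 - Complex.I) / (2 * (Real.sqrt p : ℂ))) =
        ((1 / (2 * Real.sqrt p) : ℝ) : ℂ) * (1 - Complex.I) := by push_cast; ring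
    have hre : 0 < ((1 - Complex.I) / (2 * (Real.sqrt p : ℂ))).re := by
      rw [harg, Complex.re_ofReal_mul]
      have := Real.sqrt_pos.mpr hpr
      simp only [Complex.sub_re, Complex.one_re, Complex.I_re, sub_zero, mul_one]
      positivity
    have habs := Complex.abs_arg_lt_pi_div_two_iff.mpr (Or.inl hre)
    rw [abs_lt] at habs
    apply Complex.pow_cpow_nat_inv (by norm_num)
    · push_cast; linarith [habs.1]
    · push_cast; linarith [habs.2]
  rw [v1, v2, hNp] at key
  have h1I : (1 - Complex.I) ≠ 0 := by
    intro h
    have := congrArg Complex.re h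
    simp at this
  have hI := Complex.I_sq
  field_simp at key
  have : (1 - Complex.I) * (1 + Complex.I) = 2 := by ring_nf; rw [hI]; norm_num
  apply mul_left_cancel₀ h1I
  linear_combination key - 2 * (Real.sqrt p : ℂ) * this

lemma gauss_zmod (p : ℕ) (hp : 0 < p) [NeZero (4 * p)] :
    ∑ j : ZMod (4 * p), ZMod.stdAddChar (j ^ 2) = 2 * (1 + Complex.I) * (Real.sqrt p : ℂ) := by
  rw [← gauss_aux p hp]
  rw [← (ZMod.finEquiv (4 * p)).toEquiv.sum_comp]
  refine Finset.sum_congr rfl fun j _ => ?_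
  have : (ZMod.finEquiv (4 * p)).toEquiv j = (((j : ℕ) : ℤ) : ZMod (4 * p)) := by
    obtain ⟨n, hn⟩ : ∃ n, 4 * p = n + 1 := ⟨4 * p - 1, by omega⟩
    apply ZMod.val_injective
    rw [Int.cast_natCast, ZMod.val_natCast_of_lt j.2]
    generalize 4 * p = N at *
    subst hn
    rfl
  rw [this, ← Int.cast_pow, ZMod.stdAddChar_coe]
  push_cast
  rfl

end LogHennings

namespace LogHennings

/-! ### The coproduct of the Drinfeld element, abstractly -/
section Abstract
variable {A : Type*} [Ring A] [Algebra ℂ A] {ι : Type*} [Fintype ι]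

/-- The flip as a multiplicative statement. -/
lemma comm_mul' (x y : A ⊗[ℂ] A) : TensorProduct.comm ℂ A A (x * y) =
    TensorProduct.comm ℂ A A x * TensorProduct.comm ℂ A A y :=
  map_mul (Algebra.TensorProduct.comm ℂ A A) x y

lemma drinfeld_A (α β : ι → A) (Δ : A →ₐ[ℂ] A ⊗[ℂ] A) (S : A →ₗ[ℂ] A)
    (hS : ∀ x y, S (x * y) = S y * S x)
    (h1 : ∀ x, (∑ i, α i ⊗ₜ[ℂ] β i) * Δ x =
      TensorProduct.comm ℂ A A (Δ x) * (∑ i, α i ⊗ₜ[ℂ] β i))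
    (h2 : ∑ i, Δ (α i) ⊗ₜ[ℂ] β i = ∑ i, ∑ j, (α i ⊗ₜ[ℂ] α j) ⊗ₜ[ℂ] (β i * β j))
    (hb : ∑ i, ∑ j, (S (β i) * β j) ⊗ₜ[ℂ] (α j * α i) = (1 : A ⊗[ℂ] A)) :
    ∑ i, (S (β i) ⊗ₜ[ℂ] (1 : A)) * (∑ j, β j ⊗ₜ[ℂ] α j) * (∑ j, α j ⊗ₜ[ℂ] β j) * Δ (α i) =
      ((∑ i, S (β i) * α i) ⊗ₜ[ℂ] (1 : A)) * (∑ j, α j ⊗ₜ[ℂ] β j) := by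
  set R := ∑ j, α j ⊗ₜ[ℂ] β j with hR
  set R' := ∑ j, β j ⊗ₜ[ℂ] α j with hR'
  let Φ : (A ⊗[ℂ] A) ⊗[ℂ] A →ₗ[ℂ] A ⊗[ℂ] A := TensorProduct.lift
    (LinearMap.flip ((LinearMap.mul ℂ (A ⊗[ℂ] A)).compl₂
        (TensorProduct.comm ℂ A A).toLinearMap ∘ₗ
      (LinearMap.mulRight ℂ R') ∘ₗ ((TensorProduct.mk ℂ A A).flip 1) ∘ₗ S))
  have hΦ : ∀ x z, Φ (x ⊗ₜ z) = (S z ⊗ₜ[ℂ] (1 : A)) * R' * TensorProduct.comm ℂ A A x :=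
    fun x z => rfl
  have h3 := congrArg Φ h2
  simp only [map_sum, hΦ] at h3
  have : ∀ i, (S (β i) ⊗ₜ[ℂ] (1 : A)) * R' * R * Δ (α i) =
      ((S (β i) ⊗ₜ[ℂ] (1 : A)) * R' * TensorProduct.comm ℂ A A (Δ (α i))) * R := by
    intro i; rw [mul_assoc _ R, h1, ← mul_assoc]
  simp only [this]
  rw [← Finset.sum_mul, h3]
  congr 1
  have e : ∀ i j, (S (β i * β j) ⊗ₜ[ℂ] (1 : A)) * R' *
      TensorProduct.comm ℂ A A (α i ⊗ₜ[ℂ] α j) = (S (β j) ⊗ₜ[ℂ] (1 : A)) *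
      ((S (β i) ⊗ₜ[ℂ] (1 : A)) * R' * ((1 : A) ⊗ₜ[ℂ] α i)) * (α j ⊗ₜ[ℂ] (1 : A)) := by
    intro i j
    rw [hS, TensorProduct.comm_tmul]
    rw [show (S (β j) * S (β i)) ⊗ₜ[ℂ] (1 : A) =
      (S (β j) ⊗ₜ[ℂ] (1 : A)) * (S (β i) ⊗ₜ[ℂ] (1 : A)) by
        rw [Algebra.TensorProduct.tmul_mul_tmul, one_mul]]
    rw [show α j ⊗ₜ[ℂ] α i = ((1 : A) ⊗ₜ[ℂ] α i) * (α j ⊗ₜ[ℂ] (1 : A)) by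
        rw [Algebra.TensorProduct.tmul_mul_tmul, one_mul, mul_one]]
    simp only [mul_assoc]
  simp only [e]
  rw [Finset.sum_comm]
  simp only [← Finset.sum_mul, ← Finset.mul_sum]
  have hb' : ∑ i, (S (β i) ⊗ₜ[ℂ] (1 : A)) * R' * ((1 : A) ⊗ₜ[ℂ] α i) = 1 := by
    rw [← hb]
    refine Finset.sum_congr rfl fun i _ => ?_
    rw [hR', Finset.mul_sum, Finset.sum_mul]
    refine Finset.sum_congr rfl fun j _ => ?_
    rw [Algebra.TensorProduct.tmul_mul_tmul, Algebra.TensorProduct.tmul_mul_tmul, one_mul, mul_one]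
  rw [hb']
  rw [TensorProduct.sum_tmul]
  refine Finset.sum_congr rfl fun i _ => ?_
  rw [mul_one, Algebra.TensorProduct.tmul_mul_tmul, one_mul]

lemma drinfeld_B (α β : ι → A) (Δ : A →ₐ[ℂ] A ⊗[ℂ] A) (S S' : A →ₗ[ℂ] A)
    (hS : ∀ x y, S (x * y) = S y * S x)
    (h1 : ∀ x, (∑ i, α i ⊗ₜ[ℂ] β i) * Δ x =
      TensorProduct.comm ℂ A A (Δ x) * (∑ i, α i ⊗ₜ[ℂ] β i))
    (h2 : ∑ i, Δ (α i) ⊗ₜ[ℂ] β i = ∑ i, ∑ j, (α i ⊗ₜ[ℂ] α j) ⊗ₜ[ℂ] (β i * β j))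
    (hu : ∀ x, S x * (∑ i, S (β i) * α i) = (∑ i, S (β i) * α i) * S' x)
    (hinv : (∑ i, α i ⊗ₜ[ℂ] S' (β i)) * (∑ i, α i ⊗ₜ[ℂ] β i) = 1) :
    ∑ i, ((1 : A) ⊗ₜ[ℂ] S (β i)) * (∑ j, α j ⊗ₜ[ℂ] β j) * Δ (α i) =
      (1 : A) ⊗ₜ[ℂ] (∑ i, S (β i) * α i) := by
  set R := ∑ j, α j ⊗ₜ[ℂ] β j with hR
  set u := ∑ i, S (β i) * α i with hu'
  let Φ : (A ⊗[ℂ] A) ⊗[ℂ] A →ₗ[ℂ] A ⊗[ℂ] A := TensorProduct.lift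
    (LinearMap.flip ((LinearMap.mul ℂ (A ⊗[ℂ] A)).compl₂
        (TensorProduct.comm ℂ A A).toLinearMap ∘ₗ (TensorProduct.mk ℂ A A 1) ∘ₗ S))
  have hΦ : ∀ x z, Φ (x ⊗ₜ z) = ((1 : A) ⊗ₜ[ℂ] S z) * TensorProduct.comm ℂ A A x :=
    fun x z => rfl
  have h3 := congrArg Φ h2
  simp only [map_sum, hΦ] at h3
  have : ∀ i, ((1 : A) ⊗ₜ[ℂ] S (β i)) * R * Δ (α i) =
      (((1 : A) ⊗ₜ[ℂ] S (β i)) * TensorProduct.comm ℂ A A (Δ (α i))) * R := by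
    intro i; rw [mul_assoc _ R, h1, ← mul_assoc]
  simp only [this]
  rw [← Finset.sum_mul, h3]
  have e : ∀ i j, ((1 : A) ⊗ₜ[ℂ] S (β i * β j)) *
      TensorProduct.comm ℂ A A (α i ⊗ₜ[ℂ] α j) = α j ⊗ₜ[ℂ] (S (β j) * (S (β i) * α i)) := by
    intro i j
    rw [hS, TensorProduct.comm_tmul, Algebra.TensorProduct.tmul_mul_tmul, one_mul, mul_assoc]
  simp only [e]
  rw [Finset.sum_comm]
  simp only [← TensorProduct.tmul_sum, ← Finset.mul_sum, ← hu', hu]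
  have e2 : ∀ j, α j ⊗ₜ[ℂ] (u * S' (β j)) = ((1 : A) ⊗ₜ[ℂ] u) * (α j ⊗ₜ[ℂ] S' (β j)) := by
    intro j; rw [Algebra.TensorProduct.tmul_mul_tmul, one_mul]
  simp only [e2, ← Finset.mul_sum]
  rw [mul_assoc, hinv, mul_one]

lemma drinfeld_main (α β : ι → A) (Δ : A →ₐ[ℂ] A ⊗[ℂ] A) (S S' : A →ₗ[ℂ] A)
    (hS : ∀ x y, S (x * y) = S y * S x)
    (hΔS : ∀ x, Δ (S x) = TensorProduct.map S S (TensorProduct.comm ℂ A A (Δ x)))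
    (h1 : ∀ x, (∑ i, α i ⊗ₜ[ℂ] β i) * Δ x =
      TensorProduct.comm ℂ A A (Δ x) * (∑ i, α i ⊗ₜ[ℂ] β i))
    (h2 : ∑ i, Δ (α i) ⊗ₜ[ℂ] β i = ∑ i, ∑ j, (α i ⊗ₜ[ℂ] α j) ⊗ₜ[ℂ] (β i * β j))
    (h3 : ∑ i, α i ⊗ₜ[ℂ] Δ (β i) = ∑ i, ∑ j, (α i * α j) ⊗ₜ[ℂ] (β j ⊗ₜ[ℂ] β i))
    (hb : ∑ i, ∑ j, (S (β i) * β j) ⊗ₜ[ℂ] (α j * α i) = (1 : A ⊗[ℂ] A))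
    (hu : ∀ x, S x * (∑ i, S (β i) * α i) = (∑ i, S (β i) * α i) * S' x)
    (hinv : (∑ i, α i ⊗ₜ[ℂ] S' (β i)) * (∑ i, α i ⊗ₜ[ℂ] β i) = 1) :
    (∑ j, β j ⊗ₜ[ℂ] α j) * (∑ j, α j ⊗ₜ[ℂ] β j) * Δ (∑ i, S (β i) * α i) =
      (∑ i, S (β i) * α i) ⊗ₜ[ℂ] (∑ i, S (β i) * α i) := by
  have hA := drinfeld_A α β Δ S hS h1 h2 hb
  have hB := drinfeld_B α β Δ S S' hS h1 h2 hu hinv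
  set R := ∑ j, α j ⊗ₜ[ℂ] β j with hR
  set R' := ∑ j, β j ⊗ₜ[ℂ] α j with hR'
  set u := ∑ i, S (β i) * α i with hu'
  have hτ : ∀ x, R' * TensorProduct.comm ℂ A A (Δ x) = Δ x * R' := by
    intro x
    have h := congrArg (TensorProduct.comm ℂ A A) (h1 x)
    rw [comm_mul', comm_mul'] at h
    have e : TensorProduct.comm ℂ A A R = R' := by
      rw [hR, hR', map_sum]; rfl
    have e2 : TensorProduct.comm ℂ A A (TensorProduct.comm ℂ A A (Δ x)) = Δ x := by
      simp
    rw [e, e2] at h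
    exact h
  have hM : ∀ x, R' * R * Δ x = Δ x * (R' * R) := by
    intro x
    rw [mul_assoc, h1, ← mul_assoc, hτ, mul_assoc]
  let Ψ : A ⊗[ℂ] (A ⊗[ℂ] A) →ₗ[ℂ] A ⊗[ℂ] A := TensorProduct.lift
    (LinearMap.flip ((LinearMap.mul ℂ (A ⊗[ℂ] A)).compl₂ Δ.toLinearMap ∘ₗ
      (LinearMap.mulRight ℂ (R' * R)) ∘ₗ (TensorProduct.map S S) ∘ₗ
        (TensorProduct.comm ℂ A A).toLinearMap))
  have hΨ : ∀ x z, Ψ (x ⊗ₜ z) =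
      TensorProduct.map S S (TensorProduct.comm ℂ A A z) * (R' * R) * Δ x := fun x z => rfl
  have h4 := congrArg Ψ h3
  simp only [map_sum, hΨ, ← hΔS] at h4
  have : R' * R * Δ u = ∑ i, Δ (S (β i)) * (R' * R) * Δ (α i) := by
    rw [hu', map_sum, Finset.mul_sum]
    refine Finset.sum_congr rfl fun i _ => ?_
    rw [map_mul, ← mul_assoc, hM]
  rw [this, h4]
  have e : ∀ i j, TensorProduct.map S S (TensorProduct.comm ℂ A A (β j ⊗ₜ[ℂ] β i)) * (R' * R) *
      Δ (α i * α j) = ((1 : A) ⊗ₜ[ℂ] S (β j)) *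
        ((S (β i) ⊗ₜ[ℂ] (1 : A)) * R' * R * Δ (α i)) * Δ (α j) := by
    intro i j
    rw [TensorProduct.comm_tmul, TensorProduct.map_tmul, map_mul,
      show S (β i) ⊗ₜ[ℂ] S (β j) = ((1 : A) ⊗ₜ[ℂ] S (β j)) * (S (β i) ⊗ₜ[ℂ] (1 : A)) by
        rw [Algebra.TensorProduct.tmul_mul_tmul, one_mul, mul_one]]
    simp only [mul_assoc]
  simp only [e]
  rw [Finset.sum_comm]
  simp only [← Finset.sum_mul, ← Finset.mul_sum, hA]
  have e2 : ∀ j, ((1 : A) ⊗ₜ[ℂ] S (β j)) * ((u ⊗ₜ[ℂ] (1 : A)) * R) * Δ (α j) =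
      (u ⊗ₜ[ℂ] (1 : A)) * (((1 : A) ⊗ₜ[ℂ] S (β j)) * R * Δ (α j)) := by
    intro j
    simp only [← mul_assoc]
    rw [Algebra.TensorProduct.tmul_mul_tmul, Algebra.TensorProduct.tmul_mul_tmul]
    simp only [one_mul, mul_one]
  simp only [e2, ← Finset.mul_sum, hB]
  rw [Algebra.TensorProduct.tmul_mul_tmul, one_mul, mul_one]

end Abstract
end LogHennings

namespace LogHennings

/-! ### Basic facts about `D` -/

instance instNeZeroFourP (p : ℕ) [hp : Fact (2 ≤ p)] : NeZero (4 * p) :=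
  ⟨by have := hp.out; omega⟩

section Base
variable (p : ℕ) [hp : Fact (2 ≤ p)]

/-- The character `a ↦ q^{a/2}` of `ℤ/4p`. -/
def chi : AddChar (ZMod (4 * p)) ℂ := ZMod.stdAddChar

lemma chi_int (n : ℤ) : chi p (n : ZMod (4 * p)) = qh p ^ n := by
  have h0 : (p : ℂ) ≠ 0 := by
    have := hp.out
    exact_mod_cast (by omega : p ≠ 0)
  rw [chi, ZMod.stdAddChar_coe, qh, ← Complex.exp_int_mul]
  congr 1
  push_cast
  field_simp
  ring

lemma chi_nat (n : ℕ) : chi p (n : ZMod (4 * p)) = qh p ^ n := by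
  have := chi_int p n
  simpa using this

lemma chi_ne (a : ZMod (4 * p)) : chi p a ≠ 0 := by
  intro h
  have := (chi p).map_add_eq_mul a (-a)
  rw [h, zero_mul, add_neg_cancel, AddChar.map_zero_eq_one] at this
  exact one_ne_zero this

lemma chi_neg (a : ZMod (4 * p)) : chi p (-a) = (chi p a)⁻¹ := by
  refine eq_inv_of_mul_eq_one_left ?_
  rw [← AddChar.map_add_eq_mul, neg_add_cancel, AddChar.map_zero_eq_one]

lemma qq_eq : qq p = chi p 2 := by
  have h0 : (p : ℂ) ≠ 0 := by
    have := hp.out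
    exact_mod_cast (by omega : p ≠ 0)
  have := chi_nat p 2
  rw [Nat.cast_ofNat] at this
  rw [this, qh, qq, ← Complex.exp_nat_mul]
  congr 1
  push_cast
  field_simp

lemma qq_inv_eq : (qq p)⁻¹ = chi p (-2) := by rw [qq_eq, chi_neg]

lemma qq_pow (m : ℕ) : qq p ^ m = chi p (2 * m) := by
  rw [qq_eq, ← AddChar.map_nsmul_eq_pow]; congr 1; rw [nsmul_eq_mul]; ring

lemma qq_inv_pow (m : ℕ) : (qq p)⁻¹ ^ m = chi p (-(2 * m)) := by
  rw [inv_pow, qq_pow, chi_neg]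

lemma four_p : (4 * (p : ZMod (4 * p))) = 0 := by
  have := ZMod.natCast_self (4 * p)
  push_cast at this
  exact this

lemma chi_inj {a b : ZMod (4 * p)} (h : chi p a = chi p b) : a = b :=
  ZMod.injective_stdAddChar h

lemma chi_two_p : chi p (2 * p) = -1 := by
  have h1 : chi p (2 * p) * chi p (2 * p) = 1 := by
    rw [← AddChar.map_add_eq_mul, show (2 * p + 2 * p : ZMod (4 * p)) = 4 * p by ring, four_p,
      AddChar.map_zero_eq_one]
  rcases mul_self_eq_one_iff.mp h1 with h | h
  · exfalso
    rw [← AddChar.map_zero_eq_one (chi p)] at h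
    have h2 := chi_inj p h
    have h3 : ((2 * p : ℕ) : ZMod (4 * p)) = 0 := by push_cast; exact h2
    rw [ZMod.natCast_eq_zero_iff] at h3
    have := Nat.le_of_dvd (by have := hp.out; omega) h3
    have := hp.out
    omega
  · exact h

/-- `d = q - q⁻¹`. -/
def dd : ℂ := qq p - (qq p)⁻¹

/-- `q^m - q^{-m}`. -/
def sg (m : ℕ) : ℂ := chi p (2 * m) - chi p (-(2 * m))

lemma dd_eq : dd p = chi p 2 - chi p (-2) := by rw [dd, qq_inv_eq, qq_eq]

lemma sg_ne (m : ℕ) (h0 : 0 < m) (h1 : m < p) : sg p m ≠ 0 := by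
  intro h
  have h2 := chi_inj p (sub_eq_zero.mp h)
  have h3 : ((4 * m : ℕ) : ZMod (4 * p)) = 0 := by
    push_cast
    linear_combination h2
  rw [ZMod.natCast_eq_zero_iff] at h3
  have := Nat.le_of_dvd (by omega) h3
  omega

lemma sg_one : sg p 1 = dd p := by
  rw [sg, dd, qq_inv_eq, qq_eq]; norm_num

lemma dd_ne : dd p ≠ 0 := by
  rw [← sg_one]; exact sg_ne p 1 one_pos (by have := hp.out; omega)

lemma qnum_eq (m : ℕ) : qnum p m = sg p m / dd p := by
  rw [qnum, qq_pow, qq_inv_pow, sg, dd]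

/-- `c_m = d^m / [m]!`. -/
def cc (m : ℕ) : ℂ := dd p ^ m / qfac p m

lemma qfac_ne (m : ℕ) (h : m < p) : qfac p m ≠ 0 := by
  induction m with
  | zero => simp [qfac]
  | succ m ih =>
    rw [qfac, qnum_eq]
    exact mul_ne_zero (div_ne_zero (sg_ne p _ (by omega) h) (dd_ne p)) (ih (by omega))

lemma cc_succ (m : ℕ) (h : m + 1 < p) : cc p (m + 1) * sg p (m + 1) = dd p ^ 2 * cc p m := by
  have h1 := qfac_ne p m (by omega)
  have h2 := sg_ne p (m + 1) (by omega) h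
  have h3 := dd_ne p
  rw [cc, cc, qfac, qnum_eq]
  field_simp
  ring

lemma cc_zero : cc p 0 = 1 := by simp [cc, qfac]

/-! Relations -/

lemma De_pow : De p ^ p = 0 := by
  have := RingQuot.mkAlgHom_rel ℂ (DRel.epow (p := p))
  simpa [De] using this

lemma Dphi_pow : Dphi p ^ p = 0 := by
  have := RingQuot.mkAlgHom_rel ℂ (DRel.phipow (p := p))
  simpa [Dphi] using this

lemma Dk_pow : Dk p ^ (4 * p) = 1 := by
  have := RingQuot.mkAlgHom_rel ℂ (DRel.kpow (p := p))
  simpa [Dk] using this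

lemma Dk_kinv : Dk p * Dkinv p = 1 := by
  have := RingQuot.mkAlgHom_rel ℂ (DRel.kkinv (p := p))
  simpa [Dk, Dkinv] using this

lemma Dkinv_k : Dkinv p * Dk p = 1 := by
  have := RingQuot.mkAlgHom_rel ℂ (DRel.kinvk (p := p))
  simpa [Dk, Dkinv] using this

lemma Dk_e : Dk p * De p = qq p • (De p * Dk p) := by
  have := RingQuot.mkAlgHom_rel ℂ (DRel.ke (p := p))
  rw [map_mul, map_mul, map_smul] at this
  change Dk p * De p * Dkinv p = qq p • De p at this
  rw [← smul_mul_assoc, ← this, mul_assoc, Dkinv_k, mul_one]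

lemma Dk_phi : Dk p * Dphi p = (qq p)⁻¹ • (Dphi p * Dk p) := by
  have := RingQuot.mkAlgHom_rel ℂ (DRel.kphi (p := p))
  rw [map_mul, map_mul, map_smul] at this
  change Dk p * Dphi p * Dkinv p = (qq p)⁻¹ • Dphi p at this
  rw [← smul_mul_assoc, ← this, mul_assoc, Dkinv_k, mul_one]

lemma De_phi : De p * Dphi p = Dphi p * De p + (dd p)⁻¹ • (Dk p ^ 2 - Dkinv p ^ 2) := by
  have := RingQuot.mkAlgHom_rel ℂ (DRel.ephi (p := p))
  rw [map_sub, map_mul, map_mul, map_smul, map_sub, map_pow, map_pow] at this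
  change De p * Dphi p - Dphi p * De p = (dd p)⁻¹ • (Dk p ^ 2 - Dkinv p ^ 2) at this
  rw [← this]; abel

/-- `k^a` for `a ∈ ℤ/4p`. -/
def kz (a : ZMod (4 * p)) : Dq p := Dk p ^ a.val

lemma Dk_pow_mod (n : ℕ) : Dk p ^ (n % (4 * p)) = Dk p ^ n := by
  conv_rhs => rw [← Nat.mod_add_div n (4 * p), pow_add, pow_mul, Dk_pow, one_pow, mul_one]

lemma kz_nat (n : ℕ) : kz p (n : ZMod (4 * p)) = Dk p ^ n := by
  rw [kz, ZMod.val_natCast, Dk_pow_mod]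

lemma kz_zero : kz p 0 = 1 := by
  have := kz_nat p 0
  simpa using this

lemma kz_one : kz p 1 = Dk p := by
  have := kz_nat p 1
  simpa using this

lemma kz_two : kz p 2 = Dk p ^ 2 := by
  have := kz_nat p 2
  simpa using this

lemma kz_add (a b : ZMod (4 * p)) : kz p (a + b) = kz p a * kz p b := by
  rw [kz, kz, kz, ZMod.val_add, Dk_pow_mod, pow_add]

lemma kz_neg_one : kz p (-1) = Dkinv p := by
  have h : kz p (-1) * Dk p = 1 := by
    rw [← kz_one, ← kz_add, neg_add_cancel, kz_zero]
  calc kz p (-1) = kz p (-1) * (Dk p * Dkinv p) := by rw [Dk_kinv, mul_one]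
    _ = Dkinv p := by rw [← mul_assoc, h, one_mul]

lemma kz_neg_two : kz p (-2) = Dkinv p ^ 2 := by
  rw [pow_two, ← kz_neg_one, ← kz_add]; norm_num

lemma kz_comm (a b : ZMod (4 * p)) : kz p a * kz p b = kz p b * kz p a := by
  rw [← kz_add, ← kz_add, add_comm]

lemma kz_e (a : ZMod (4 * p)) : kz p a * De p = chi p (2 * a) • (De p * kz p a) := by
  have h : ∀ n : ℕ, Dk p ^ n * De p = qq p ^ n • (De p * Dk p ^ n) := by
    intro n
    induction n with
    | zero => simp
    | succ n ih =>
      rw [pow_succ, mul_assoc, Dk_e, mul_smul_comm, ← mul_assoc, ih, smul_mul_assoc, smul_smul,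
        pow_succ, mul_assoc, mul_comm (qq p)]
  rw [kz, h, qq_pow, ZMod.natCast_zmod_val]

lemma kz_phi (a : ZMod (4 * p)) : kz p a * Dphi p = chi p (-(2 * a)) • (Dphi p * kz p a) := by
  have h : ∀ n : ℕ, Dk p ^ n * Dphi p = (qq p)⁻¹ ^ n • (Dphi p * Dk p ^ n) := by
    intro n
    induction n with
    | zero => simp
    | succ n ih =>
      rw [pow_succ, mul_assoc, Dk_phi, mul_smul_comm, ← mul_assoc, ih, smul_mul_assoc, smul_smul,
        pow_succ, mul_assoc, mul_comm ((qq p)⁻¹)]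
  rw [kz, h, qq_inv_pow, ZMod.natCast_zmod_val]

lemma kz_e_pow (a : ZMod (4 * p)) (m : ℕ) :
    kz p a * De p ^ m = chi p (2 * a * m) • (De p ^ m * kz p a) := by
  induction m with
  | zero => simp
  | succ m ih =>
    rw [pow_succ, ← mul_assoc, ih, smul_mul_assoc, mul_assoc (De p ^ m), kz_e, mul_smul_comm, smul_smul,
      ← AddChar.map_add_eq_mul, mul_assoc (De p ^ m)]
    congr 2; push_cast; ring

lemma kz_phi_pow (a : ZMod (4 * p)) (m : ℕ) :
    kz p a * Dphi p ^ m = chi p (-(2 * a * m)) • (Dphi p ^ m * kz p a) := by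
  induction m with
  | zero => simp
  | succ m ih =>
    rw [pow_succ, ← mul_assoc, ih, smul_mul_assoc, mul_assoc (Dphi p ^ m), kz_phi, mul_smul_comm, smul_smul,
      ← AddChar.map_add_eq_mul, mul_assoc (Dphi p ^ m)]
    congr 2; push_cast; ring

lemma e_pow_kz (a : ZMod (4 * p)) (m : ℕ) :
    De p ^ m * kz p a = chi p (-(2 * a * m)) • (kz p a * De p ^ m) := by
  rw [kz_e_pow, smul_smul, ← AddChar.map_add_eq_mul, neg_add_cancel, AddChar.map_zero_eq_one,
    one_smul]

lemma phi_pow_kz (a : ZMod (4 * p)) (m : ℕ) :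
    Dphi p ^ m * kz p a = chi p (2 * a * m) • (kz p a * Dphi p ^ m) := by
  rw [kz_phi_pow, smul_smul, ← AddChar.map_add_eq_mul, add_neg_cancel, AddChar.map_zero_eq_one,
    one_smul]

/-- The idempotent projecting on the eigenspace `k = q^{a/2}`. -/
def Id (a : ZMod (4 * p)) : Dq p := (4 * (p : ℂ))⁻¹ • ∑ n, chi p (-(a * n)) • kz p n

lemma kz_Id (b a : ZMod (4 * p)) : kz p b * Id p a = chi p (a * b) • Id p a := by
  rw [Id, mul_smul_comm, smul_comm]
  congr 1
  rw [Finset.mul_sum, Finset.smul_sum]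
  refine Fintype.sum_equiv (Equiv.addRight b) _ _ fun n => ?_
  rw [mul_smul_comm, ← kz_add, smul_smul, ← AddChar.map_add_eq_mul, Equiv.coe_addRight]
  congr 2 <;> ring

lemma Id_kz (b a : ZMod (4 * p)) : Id p a * kz p b = chi p (a * b) • Id p a := by
  rw [← kz_Id, Id, mul_smul_comm, smul_mul_assoc, Finset.mul_sum, Finset.sum_mul]
  congr 1
  refine Finset.sum_congr rfl fun n _ => ?_
  rw [mul_smul_comm, smul_mul_assoc, kz_comm]

lemma four_p_ne : (4 * (p : ℂ)) ≠ 0 := by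
  have := hp.out
  have : p ≠ 0 := by omega
  simp [this]

lemma sum_chi (b : ZMod (4 * p)) : ∑ x, chi p (x * b) = if b = 0 then 4 * (p : ℂ) else 0 := by
  rw [chi, AddChar.sum_mulShift b (ZMod.isPrimitive_stdAddChar (4 * p)), ZMod.card]
  push_cast
  rfl

lemma sum_Id : ∑ a, Id p a = 1 := by
  simp only [Id]
  rw [← Finset.smul_sum, Finset.sum_comm]
  simp only [← Finset.sum_smul]
  have : ∀ n : ZMod (4 * p), ∑ a, chi p (-(a * n)) = if n = 0 then 4 * (p : ℂ) else 0 := by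
    intro n
    have := sum_chi p (-n)
    simp only [neg_eq_zero, mul_neg] at this
    exact this
  simp only [this, ite_smul, zero_smul]
  rw [Finset.sum_ite_eq' Finset.univ, if_pos (Finset.mem_univ _), smul_smul,
    inv_mul_cancel₀ (four_p_ne p), one_smul, kz_zero]

lemma Id_mul (a b : ZMod (4 * p)) : Id p a * Id p b = if a = b then Id p b else 0 := by
  conv_lhs => rw [Id]
  rw [smul_mul_assoc, Finset.sum_mul]
  simp only [smul_mul_assoc, kz_Id, smul_smul, ← AddChar.map_add_eq_mul]
  rw [← Finset.sum_smul, smul_smul]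
  have : ∑ n, chi p (-(a * n) + b * n) = if b - a = 0 then 4 * (p : ℂ) else 0 := by
    rw [← sum_chi]
    refine Finset.sum_congr rfl fun n _ => ?_
    congr 1; ring
  rw [this]
  by_cases h : a = b
  · rw [if_pos h, if_pos (by rw [h, sub_self]), inv_mul_cancel₀ (four_p_ne p), one_smul]
  · rw [if_neg h, if_neg (by rw [sub_eq_zero]; exact fun h' => h h'.symm), mul_zero, zero_smul]

lemma kz_eq (b : ZMod (4 * p)) : kz p b = ∑ a, chi p (a * b) • Id p a := by
  rw [← mul_one (kz p b), ← sum_Id, Finset.mul_sum]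
  simp only [kz_Id]

lemma e_pow_Id (a : ZMod (4 * p)) (m : ℕ) :
    De p ^ m * Id p a = Id p (a + 2 * m) * De p ^ m := by
  rw [Id, Id, mul_smul_comm, smul_mul_assoc, Finset.mul_sum, Finset.sum_mul]
  congr 1
  refine Finset.sum_congr rfl fun n _ => ?_
  rw [mul_smul_comm, smul_mul_assoc, e_pow_kz, smul_smul, ← AddChar.map_add_eq_mul]
  congr 2; ring

lemma phi_pow_Id (a : ZMod (4 * p)) (m : ℕ) :
    Dphi p ^ m * Id p a = Id p (a - 2 * m) * Dphi p ^ m := by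
  rw [Id, Id, mul_smul_comm, smul_mul_assoc, Finset.mul_sum, Finset.sum_mul]
  congr 1
  refine Finset.sum_congr rfl fun n _ => ?_
  rw [mul_smul_comm, smul_mul_assoc, phi_pow_kz, smul_smul, ← AddChar.map_add_eq_mul]
  congr 2; ring

/-- the element `q^{b} k² - q^{-b} k⁻²` with `chi` normalisation. -/
def HH (b : ZMod (4 * p)) : Dq p := chi p b • kz p 2 - chi p (-b) • kz p (-2)

lemma sg_succ_aux (m : ℕ) : sg p (m + 1) = chi p 2 * sg p m + dd p * chi p (-(2 * m)) := by
  rw [sg, sg, dd, qq_inv_eq, qq_eq, mul_sub, sub_mul]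
  simp only [← AddChar.map_add_eq_mul]
  push_cast
  ring_nf

lemma sg_aux1 (m : ℕ) : sg p (m + 1) * chi p (-(2 * m) + -4) + dd p
    = sg p (m + 2) * chi p (-(2 * (m + 1))) := by
  simp only [sg, dd_eq, sub_mul, ← AddChar.map_add_eq_mul]
  push_cast
  ring_nf

lemma sg_aux2 (m : ℕ) : sg p (m + 1) * chi p (2 * m + 4) + dd p
    = sg p (m + 2) * chi p (2 * (m + 1)) := by
  simp only [sg, dd_eq, sub_mul, ← AddChar.map_add_eq_mul]
  push_cast
  ring_nf

lemma e_phi_pow (m : ℕ) : De p * Dphi p ^ (m + 1) =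
    Dphi p ^ (m + 1) * De p + (sg p (m + 1) / dd p ^ 2) • (Dphi p ^ m * HH p (-(2 * m))) := by
  have hd := dd_ne p
  have hR : De p * Dphi p = Dphi p * De p + (dd p)⁻¹ • (kz p 2 - kz p (-2)) := by
    rw [De_phi, kz_two, kz_neg_two]
  induction m with
  | zero =>
    rw [zero_add, pow_one, hR, sg_one, HH]
    simp only [Nat.cast_zero, mul_zero, neg_zero, AddChar.map_zero_eq_one, one_smul, pow_zero,
      one_mul]
    congr 2
    field_simp
  | succ m ih =>
    have h1 := sg_aux1 p m
    have h2 := sg_aux2 p m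
    rw [pow_succ, ← mul_assoc, ih, add_mul, mul_assoc _ (De p), hR, mul_add, ← mul_assoc,
      add_assoc]
    congr 1
    rw [smul_mul_assoc, mul_assoc (Dphi p ^ m), HH, HH, sub_mul, smul_mul_assoc, smul_mul_assoc,
      kz_phi, kz_phi]
    simp only [smul_smul, mul_smul_comm, mul_sub, ← mul_assoc, ← pow_succ, smul_sub,
      ← AddChar.map_add_eq_mul]
    match_scalars
    · push_cast
      field_simp
      ring_nf at h1 ⊢
      linear_combination h1
    · push_cast
      field_simp
      ring_nf at h2 ⊢
      linear_combination -h2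

lemma e_pow_phi (m : ℕ) : De p ^ (m + 1) * Dphi p =
    Dphi p * De p ^ (m + 1) + (sg p (m + 1) / dd p ^ 2) • (HH p (-(2 * m)) * De p ^ m) := by
  have hd := dd_ne p
  have hR : De p * Dphi p = Dphi p * De p + (dd p)⁻¹ • (kz p 2 - kz p (-2)) := by
    rw [De_phi, kz_two, kz_neg_two]
  induction m with
  | zero =>
    rw [zero_add, pow_one, hR, sg_one, HH]
    simp only [Nat.cast_zero, mul_zero, neg_zero, AddChar.map_zero_eq_one, one_smul, pow_zero,
      mul_one]
    congr 2
    field_simp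
  | succ m ih =>
    have h1 := sg_aux1 p m
    have h2 := sg_aux2 p m
    rw [pow_succ', mul_assoc, ih, mul_add, ← mul_assoc, hR, add_mul, mul_assoc (Dphi p),
      add_assoc]
    congr 1
    have h3 : ∀ a, De p * kz p a = chi p (-(2 * a)) • (kz p a * De p) := by
      intro a
      simpa using e_pow_kz p a 1
    rw [mul_smul_comm, ← mul_assoc, HH, HH, mul_sub, mul_smul_comm, mul_smul_comm, h3, h3]
    simp only [smul_smul, smul_mul_assoc, sub_mul, mul_assoc, ← pow_succ', smul_sub,
      ← AddChar.map_add_eq_mul]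
    match_scalars
    · push_cast
      field_simp
      ring_nf at h1 ⊢
      linear_combination h1
    · push_cast
      field_simp
      ring_nf at h2 ⊢
      linear_combination -h2
end Base
end LogHennings

namespace LogHennings
section Rib
variable (p : ℕ) [hp : Fact (2 ≤ p)]

lemma Dq_induction {P : Dq p → Prop} (hC : ∀ c : ℂ, P (algebraMap ℂ (Dq p) c))
    (he : P (De p)) (hphi : P (Dphi p)) (hk : P (Dk p)) (hkinv : P (Dkinv p))
    (hadd : ∀ x y, P x → P y → P (x + y)) (hmul : ∀ x y, P x → P y → P (x * y))
    (x : Dq p) : P x := by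
  obtain ⟨y, rfl⟩ := RingQuot.mkAlgHom_surjective ℂ (DRel p) x
  induction y using FreeAlgebra.induction with
  | grade0 c => rw [AlgHom.commutes]; exact hC c
  | grade1 g =>
    cases g
    · exact he
    · exact hphi
    · exact hk
    · exact hkinv
  | mul a b ha hb => rw [map_mul]; exact hmul _ _ ha hb
  | add a b ha hb => rw [map_add]; exact hadd _ _ ha hb

lemma sum_zmod_eq_range {M : Type*} [AddCommMonoid M] (f : ZMod (4 * p) → M) :
    ∑ a, f a = ∑ n ∈ range (4 * p), f (n : ZMod (4 * p)) := by
  symm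
  refine Finset.sum_bij' (fun n _ => (n : ZMod (4 * p))) (fun a _ => a.val) ?_ ?_ ?_ ?_ ?_
  · intros; exact mem_univ _
  · intro a _; exact mem_range.mpr (ZMod.val_lt a)
  · intro n hn; exact ZMod.val_cast_of_lt (mem_range.mp hn)
  · intro a _; exact ZMod.natCast_zmod_val a
  · intros; rfl

lemma sum_range_pred {M : Type*} [AddCommMonoid M] (f : ℕ → M) :
    ∑ m ∈ range p, f m = ∑ m ∈ range (p - 1), f m + f (p - 1) := by
  have := hp.out
  rw [← Finset.sum_range_succ, show p - 1 + 1 = p by omega]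

lemma sum_range_pred' {M : Type*} [AddCommMonoid M] (f : ℕ → M) :
    ∑ m ∈ range p, f m = ∑ m ∈ range (p - 1), f (m + 1) + f 0 := by
  have := hp.out
  rw [← Finset.sum_range_succ', show p - 1 + 1 = p by omega]

lemma gauss_half (c : ZMod (4 * p)) :
    ((1 - Complex.I) / (2 * (Real.sqrt p : ℂ))) *
      ∑ j ∈ range (2 * p), chi p (((j : ZMod (4 * p)) + c) ^ 2) = 1 := by
  have hp0 : 0 < p := by have := hp.out; omega
  have h1 := gauss_zmod p hp0
  have h2 : ∑ j : ZMod (4 * p), chi p ((j + c) ^ 2) = 2 * (1 + Complex.I) * (Real.sqrt p : ℂ) := by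
    rw [← h1]
    exact Fintype.sum_equiv (Equiv.addRight c) _ _ fun n => rfl
  have h6 : ∀ f : ℕ → ℂ, ∑ n ∈ range (4 * p), f n =
      ∑ n ∈ range (2 * p), f n + ∑ n ∈ range (2 * p), f (2 * p + n) := by
    intro f
    rw [show 4 * p = 2 * p + 2 * p by ring, Finset.sum_range_add]
  rw [sum_zmod_eq_range, h6] at h2
  have h3 : ∀ x ∈ range (2 * p), chi p ((((2 * p + x : ℕ) : ZMod (4 * p)) + c) ^ 2)
      = chi p (((x : ZMod (4 * p)) + c) ^ 2) := by
    intro x _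
    congr 1
    push_cast
    linear_combination (p + x + c) * four_p p
  rw [Finset.sum_congr rfl h3, ← two_mul] at h2
  have h4 : ∑ j ∈ range (2 * p), chi p (((j : ZMod (4 * p)) + c) ^ 2)
    = (1 + Complex.I) * (Real.sqrt p : ℂ) := by linear_combination h2 / 2
  rw [h4]
  have h5 : (Real.sqrt p : ℂ) ≠ 0 := by
    have : Real.sqrt p ≠ 0 := by
      rw [Real.sqrt_ne_zero']; exact_mod_cast hp0
    exact_mod_cast this
  field_simp
  linear_combination -Complex.I_sq

/-- Phase of the ribbon element. -/
def ww (m : ℕ) (a : ZMod (4 * p)) : ℂ :=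
  chi p (-m - (m + a) ^ 2 - 2 * (m + a) * (p + 1))

lemma rib_eq : rib p = ∑ m ∈ range p, ∑ a, (cc p m * ww p m a) •
    (Dphi p ^ m * De p ^ m * Id p a) := by
  rw [rib, Finset.smul_sum]
  refine Finset.sum_congr rfl fun m _ => ?_
  have h1 : ∀ j : ℕ, Dphi p ^ m * De p ^ m * Dk p ^ (2 * j) =
      ∑ a, chi p (a * (2 * j)) • (Dphi p ^ m * De p ^ m * Id p a) := by
    intro j
    rw [← kz_nat, kz_eq, Finset.mul_sum]
    push_cast
    simp only [mul_smul_comm]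
  simp only [h1, Finset.smul_sum, smul_smul]
  rw [Finset.sum_comm]
  refine Finset.sum_congr rfl fun a _ => ?_
  rw [← Finset.sum_smul]
  congr 1
  have h2 := gauss_half p (p + 1 + m + a)
  have h3 : cc p m * ww p m a = cc p m * ww p m a * (((1 - Complex.I) / (2 * (Real.sqrt p : ℂ))) *
      ∑ j ∈ range (2 * p), chi p (((j : ZMod (4 * p)) + (p + 1 + m + a)) ^ 2)) := by
    rw [h2, mul_one]
  rw [h3, mul_left_comm]
  simp only [Finset.mul_sum]
  refine Finset.sum_congr rfl fun j _ => ?_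
  have h4 : chi p ((-(m : ℤ) + 2 * (m : ℤ) * (j : ℤ) + ((j : ℤ) + (p : ℤ) + 1) ^ 2 : ℤ)) *
      chi p (a * (2 * j)) = ww p m a * chi p (((j : ZMod (4 * p)) + (p + 1 + m + a)) ^ 2) := by
    rw [ww, ← AddChar.map_add_eq_mul, ← AddChar.map_add_eq_mul]
    congr 1
    push_cast
    ring
  rw [← chi_int, cc, dd]
  linear_combination ((1 - Complex.I) / (2 * (Real.sqrt p : ℂ)) *
    ((qq p - (qq p)⁻¹) ^ m / qfac p m)) * h4

lemma ww_rel (m : ℕ) (a : ZMod (4 * p)) :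
    ww p (m + 1) a * (chi p (2 * (m + 2 + a)) - chi p (-(2 * (m + 2 + a)))) =
      ww p m (a + 2) - ww p m a := by
  have h1 : ww p (m + 1) a * chi p (2 * (m + 2 + a)) = chi p (2 * p) * ww p m a := by
    simp only [ww, ← AddChar.map_add_eq_mul]
    congr 1
    push_cast
    linear_combination - four_p p
  have h2 : ww p (m + 1) a * chi p (-(2 * (m + 2 + a))) = chi p (2 * p) * ww p m (a + 2) := by
    simp only [ww, ← AddChar.map_add_eq_mul]
    congr 1
    push_cast
    ring
  rw [mul_sub, h1, h2, chi_two_p]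
  ring


lemma HH_Id (b a : ZMod (4 * p)) :
    HH p b * Id p a = (chi p (b + 2 * a) - chi p (-(b + 2 * a))) • Id p a := by
  rw [HH, sub_mul, smul_mul_assoc, smul_mul_assoc, kz_Id, kz_Id, smul_smul, smul_smul, ← sub_smul]
  simp only [← AddChar.map_add_eq_mul]
  congr 3 <;> ring

lemma Id_HH (b a : ZMod (4 * p)) :
    Id p a * HH p b = (chi p (b + 2 * a) - chi p (-(b + 2 * a))) • Id p a := by
  rw [HH, mul_sub, mul_smul_comm, mul_smul_comm, Id_kz, Id_kz, smul_smul, smul_smul, ← sub_smul]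
  simp only [← AddChar.map_add_eq_mul]
  congr 3 <;> ring

lemma rib_kz (b : ZMod (4 * p)) : rib p * kz p b = kz p b * rib p := by
  rw [rib_eq, Finset.sum_mul, Finset.mul_sum]
  refine Finset.sum_congr rfl fun m _ => ?_
  rw [Finset.sum_mul, Finset.mul_sum]
  refine Finset.sum_congr rfl fun a _ => ?_
  rw [smul_mul_assoc, mul_smul_comm]
  congr 1
  rw [mul_assoc _ (Id p a), Id_kz, ← mul_assoc, ← mul_assoc, kz_phi_pow, smul_mul_assoc,
    mul_assoc (Dphi p ^ m) (kz p b), kz_e_pow, mul_smul_comm, mul_smul_comm, smul_mul_assoc, smul_mul_assoc, smul_smul,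
    ← AddChar.map_add_eq_mul, neg_add_cancel, AddChar.map_zero_eq_one, one_smul, ← mul_assoc,
    mul_assoc _ (kz p b), kz_Id, mul_smul_comm]

lemma rib_e : rib p * De p = De p * rib p := by
  have hp0 := hp.out
  have hd := dd_ne p
  -- both sides in the form of sums over `φ^m e^(m+1) Id a`
  have hL : rib p * De p = ∑ m ∈ range p, ∑ a, (cc p m * ww p m (a + 2)) •
      (Dphi p ^ m * De p ^ (m + 1) * Id p a) := by
    rw [rib_eq, Finset.sum_mul]
    refine Finset.sum_congr rfl fun m _ => ?_
    rw [Finset.sum_mul]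
    symm
    refine Fintype.sum_equiv (Equiv.addRight 2) _ _ fun a => ?_
    rw [Equiv.coe_addRight, smul_mul_assoc]
    congr 1
    have := e_pow_Id p a 1
    rw [pow_one, Nat.cast_one, mul_one] at this
    rw [pow_succ, mul_assoc, mul_assoc (De p ^ m), this, ← mul_assoc, ← mul_assoc]
  have hR : De p * rib p = ∑ m ∈ range p, ∑ a, (cc p m * ww p m a) •
      (Dphi p ^ m * De p ^ (m + 1) * Id p a) +
      ∑ m ∈ range (p - 1), ∑ a, (cc p (m + 1) * ww p (m + 1) a * (sg p (m + 1) / dd p ^ 2) *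
        (chi p (2 * (m + 2 + a)) - chi p (-(2 * (m + 2 + a))))) •
      (Dphi p ^ m * De p ^ (m + 1) * Id p a) := by
    have h2 := sum_range_pred' p (M := Dq p)
    rw [rib_eq, Finset.mul_sum, h2, h2, add_right_comm, ← Finset.sum_add_distrib]
    congr 1
    · refine Finset.sum_congr rfl fun m _ => ?_
      rw [Finset.mul_sum, ← Finset.sum_add_distrib]
      refine Finset.sum_congr rfl fun a _ => ?_
      rw [mul_smul_comm, ← mul_assoc, ← mul_assoc, e_phi_pow, add_mul, add_mul, smul_add,
        mul_assoc _ (De p), ← pow_succ']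
      congr 1
      have h3 : HH p (-(2 * m)) * (De p ^ (m + 1) * Id p a) =
          (chi p (2 * (m + 2 + a)) - chi p (-(2 * (m + 2 + a)))) • (De p ^ (m + 1) * Id p a) := by
        rw [e_pow_Id, ← mul_assoc, HH_Id, smul_mul_assoc]
        congr 3
        · push_cast; ring
        · push_cast; ring
      rw [smul_mul_assoc, smul_mul_assoc, mul_assoc, mul_assoc (Dphi p ^ m), h3, mul_smul_comm,
        smul_smul, smul_smul, ← mul_assoc]
    · rw [Finset.mul_sum]
      refine Finset.sum_congr rfl fun a _ => ?_
      rw [mul_smul_comm]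
      simp
  have h1 : p = (p - 1) + 1 := by omega
  have h2 := sum_range_pred p (M := Dq p)
  have h3 : De p ^ (p - 1 + 1) = 0 := by rw [show p - 1 + 1 = p by omega, De_pow]
  rw [hL, hR, h2, h2]
  simp only [h3, mul_zero, zero_mul, smul_zero, Finset.sum_const_zero, add_zero]
  rw [← Finset.sum_add_distrib]
  refine Finset.sum_congr rfl fun m hm => ?_
  rw [← Finset.sum_add_distrib]
  refine Finset.sum_congr rfl fun a _ => ?_
  rw [← add_smul]
  congr 1
  have h4 := ww_rel p m a
  have h5 := cc_succ p m (by have := mem_range.mp hm; omega)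
  have h6 : cc p (m + 1) * (sg p (m + 1) / dd p ^ 2) = cc p m := by
    field_simp
    linear_combination h5
  linear_combination (-ww p (m + 1) a * (chi p (2 * (m + 2 + a)) - chi p (-(2 * (m + 2 + a)))))
    * h6 - cc p m * h4

lemma rib_phi : rib p * Dphi p = Dphi p * rib p := by
  have hp0 := hp.out
  have hd := dd_ne p
  have hR : Dphi p * rib p = ∑ m ∈ range p, ∑ a, (cc p m * ww p m a) •
      (Dphi p ^ (m + 1) * De p ^ m * Id p a) := by
    rw [rib_eq, Finset.mul_sum]
    refine Finset.sum_congr rfl fun m _ => ?_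
    rw [Finset.mul_sum]
    refine Finset.sum_congr rfl fun a _ => ?_
    rw [mul_smul_comm, pow_succ']
    simp only [mul_assoc]
  have hI : ∀ a, Id p (a + 2) * Dphi p = Dphi p * Id p (a + 4) := by
    intro a
    have := phi_pow_Id p (a + 4) 1
    rw [pow_one, Nat.cast_one, mul_one] at this
    rw [this]; congr 2; ring
  have hL : rib p * Dphi p = ∑ m ∈ range p, ∑ a, (cc p m * ww p m (a - 2)) •
      (Dphi p ^ (m + 1) * De p ^ m * Id p a) +
      ∑ m ∈ range (p - 1), ∑ a, (cc p (m + 1) * ww p (m + 1) (a - 2) * (sg p (m + 1) / dd p ^ 2) *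
        (chi p (2 * (m + a)) - chi p (-(2 * (m + a))))) •
      (Dphi p ^ (m + 1) * De p ^ m * Id p a) := by
    have h2 := sum_range_pred' p (M := Dq p)
    have h4 : ∀ a, Id p (a - 2) * Dphi p = Dphi p * Id p a := by
      intro a
      have := phi_pow_Id p a 1
      rw [pow_one, Nat.cast_one, mul_one] at this
      rw [this]
    have hsh : rib p = ∑ m ∈ range p, ∑ a, (cc p m * ww p m (a - 2)) •
        (Dphi p ^ m * De p ^ m * Id p (a - 2)) := by
      rw [rib_eq]
      refine Finset.sum_congr rfl fun m _ => ?_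
      symm
      exact Fintype.sum_equiv (Equiv.subRight 2) _ _ fun a => rfl
    rw [hsh, Finset.sum_mul, h2, h2, add_right_comm, ← Finset.sum_add_distrib]
    congr 1
    · refine Finset.sum_congr rfl fun m _ => ?_
      rw [Finset.sum_mul, ← Finset.sum_add_distrib]
      refine Finset.sum_congr rfl fun a _ => ?_
      rw [smul_mul_assoc, mul_assoc, h4, ← mul_assoc, mul_assoc _ _ (Dphi p), e_pow_phi,
        mul_add, add_mul, smul_add,
        ← mul_assoc, ← pow_succ]
      congr 1
      have h3 : HH p (-(2 * m)) * (De p ^ m * Id p a) =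
          (chi p (2 * (m + a)) - chi p (-(2 * (m + a)))) • (De p ^ m * Id p a) := by
        rw [e_pow_Id, ← mul_assoc, HH_Id, smul_mul_assoc]
        congr 3
        · ring
        · ring
      rw [mul_smul_comm, smul_mul_assoc, mul_assoc, mul_assoc (HH p _), h3, mul_smul_comm,
        smul_smul, smul_smul, mul_assoc (Dphi p ^ (m + 1)), mul_assoc]
    · rw [Finset.sum_mul]
      refine Finset.sum_congr rfl fun a _ => ?_
      rw [smul_mul_assoc, mul_assoc, h4]
      simp
  have h1 : p = (p - 1) + 1 := by omega
  have h2 := sum_range_pred p (M := Dq p)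
  have h3 : Dphi p ^ (p - 1 + 1) = 0 := by rw [show p - 1 + 1 = p by omega, Dphi_pow]
  rw [hL, hR, h2, h2]
  simp only [h3, zero_mul, smul_zero, Finset.sum_const_zero, add_zero]
  rw [← Finset.sum_add_distrib]
  refine Finset.sum_congr rfl fun m hm => ?_
  rw [← Finset.sum_add_distrib]
  refine Finset.sum_congr rfl fun a _ => ?_
  rw [← add_smul]
  congr 1
  have h4 := ww_rel p m (a - 2)
  rw [sub_add_cancel, show (m + 2 + (a - 2) : ZMod (4 * p)) = m + a by ring] at h4
  have h5 := cc_succ p m (by have := mem_range.mp hm; omega)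
  have h6 : cc p (m + 1) * (sg p (m + 1) / dd p ^ 2) = cc p m := by
    field_simp
    linear_combination h5
  linear_combination (ww p (m + 1) (a - 2) * (chi p (2 * (m + a)) - chi p (-(2 * (m + a)))))
    * h6 + cc p m * h4

lemma rib_central (x : Dq p) : rib p * x = x * rib p := by
  induction x using Dq_induction with
  | hC c => exact (Algebra.commutes c _).symm
  | he => exact rib_e p
  | hphi => exact rib_phi p
  | hk => rw [← kz_one]; exact rib_kz p 1
  | hkinv => rw [← kz_neg_one]; exact rib_kz p (-1)
  | hadd x y hx hy => rw [mul_add, add_mul, hx, hy]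
  | hmul x y hx hy => rw [← mul_assoc, hx, mul_assoc, hy, mul_assoc]

lemma eps_rib (ε : Dq p →ₐ[ℂ] ℂ) (hε : IsCounitD p ε) : ε (rib p) = 1 := by
  have hp0 := hp.out
  obtain ⟨h1, h2, h3, h4⟩ := hε
  rw [rib, map_smul, map_sum, smul_eq_mul]
  refine Eq.trans ?_ (gauss_half p (p + 1))
  congr 1
  rw [Finset.sum_eq_single 0]
  · rw [map_sum]
    refine Finset.sum_congr rfl fun j _ => ?_
    rw [map_smul, ← chi_int]
    simp only [pow_zero, one_mul, map_pow, h3, one_pow, smul_eq_mul, mul_one, qfac, div_one]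
    congr 1
    push_cast
    ring
  · intro m _ hm
    simp [h1, hm]
  · intro h
    exact absurd (mem_range.mpr (by omega)) h

end Rib
end LogHennings

namespace LogHennings
section RM
variable (p : ℕ) [hp : Fact (2 ≤ p)]

/-- Coefficients of the `R`-matrix. -/
def tt (m : ℕ) : ℂ := cc p m * chi p (m * (m - 1))

lemma tt_zero : tt p 0 = 1 := by
  simp [tt, cc_zero]

lemma tt_succ (m : ℕ) (h : m + 1 < p) :
    tt p (m + 1) * sg p (m + 1) = dd p ^ 2 * (chi p (2 * m) * tt p m) := by
  have h1 := cc_succ p m h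
  have h2 : chi p (((m + 1 : ℕ) : ZMod (4 * p)) * ((m + 1 : ℕ) - 1)) =
      chi p (2 * m) * chi p (m * (m - 1)) := by
    rw [← AddChar.map_add_eq_mul]; congr 1; push_cast; ring
  rw [tt, tt, h2]
  linear_combination chi p (2 * m) * chi p (m * (m - 1)) * h1

lemma sg_zero : sg p 0 = 0 := by simp [sg]

lemma sg_add (m n : ℕ) : sg p (m + n) = chi p (-(2 * m)) * sg p n + chi p (2 * n) * sg p m := by
  simp only [sg, mul_sub, ← AddChar.map_add_eq_mul]
  push_cast
  ring_nf

lemma qcomm_pow {A : Type*} [Ring A] [Algebra ℂ A] (x y : A) (hyx : y * x = chi p 4 • (x * y))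
    (i : ℕ) : x * y ^ i = chi p (-(4 * i)) • (y ^ i * x) := by
  have h : x * y = chi p (-4) • (y * x) := by
    rw [hyx, smul_smul, ← AddChar.map_add_eq_mul, neg_add_cancel, AddChar.map_zero_eq_one, one_smul]
  induction i with
  | zero => simp
  | succ i ih =>
    rw [pow_succ, ← mul_assoc, ih, smul_mul_assoc, mul_assoc (y ^ i), h, mul_smul_comm, smul_smul,
      ← AddChar.map_add_eq_mul, ← mul_assoc]
    congr 2; push_cast; ring

lemma qbinom {A : Type*} [Ring A] [Algebra ℂ A] (x y : A) (hyx : y * x = chi p 4 • (x * y))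
    (N : ℕ) (hN : N < p) : tt p N • (x + y) ^ N =
      ∑ ij ∈ antidiagonal N, (tt p ij.1 * tt p ij.2) • (y ^ ij.1 * x ^ ij.2) := by
  induction N with
  | zero => simp [tt_zero]
  | succ N ih =>
    have hd := dd_ne p
    have hs := sg_ne p (N + 1) (by omega) hN
    have h1 := tt_succ p N hN
    have ih := ih (by omega)
    have key : (chi p (2 * N)) • ((x + y) * (tt p N • (x + y) ^ N)) =
        (sg p (N + 1) / dd p ^ 2) • ∑ ij ∈ antidiagonal (N + 1), (tt p ij.1 * tt p ij.2) •
          (y ^ ij.1 * x ^ ij.2) := by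
      have hA : ∑ ij ∈ antidiagonal (N + 1), (chi p (-(2 * (ij.1 : ZMod (4 * p)))) *
          sg p ij.2 / dd p ^ 2 * (tt p ij.1 * tt p ij.2)) • (y ^ ij.1 * x ^ ij.2) =
          ∑ ij ∈ antidiagonal N, (chi p (2 * N) * tt p ij.1 * tt p ij.2) •
            (x * (y ^ ij.1 * x ^ ij.2)) := by
        rw [Finset.Nat.sum_antidiagonal_succ']
        simp only [sg_zero, mul_zero, zero_div, zero_mul, zero_smul, zero_add]
        refine Finset.sum_congr rfl fun ij hij => ?_
        have h2 := mem_antidiagonal.mp hij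
        have h3 := tt_succ p ij.2 (by omega)
        rw [← mul_assoc x, qcomm_pow p x y hyx, smul_mul_assoc, smul_smul, mul_assoc (y ^ ij.1),
          ← pow_succ']
        congr 1
        have h4 : chi p (2 * N) * chi p (-(4 * ij.1)) = chi p (-(2 * ij.1)) * chi p (2 * ij.2) := by
          rw [← AddChar.map_add_eq_mul, ← AddChar.map_add_eq_mul, ← h2]
          congr 1; push_cast; ring
        field_simp
        linear_combination chi p (-(2 * ij.1)) * tt p ij.1 * h3
          - dd p ^ 2 * tt p ij.1 * tt p ij.2 * h4
      have hB : ∑ ij ∈ antidiagonal (N + 1), (chi p (2 * (ij.2 : ZMod (4 * p))) *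
          sg p ij.1 / dd p ^ 2 * (tt p ij.1 * tt p ij.2)) • (y ^ ij.1 * x ^ ij.2) =
          ∑ ij ∈ antidiagonal N, (chi p (2 * N) * tt p ij.1 * tt p ij.2) •
            (y * (y ^ ij.1 * x ^ ij.2)) := by
        rw [Finset.Nat.sum_antidiagonal_succ]
        simp only [sg_zero, mul_zero, zero_div, zero_mul, zero_smul, zero_add]
        refine Finset.sum_congr rfl fun ij hij => ?_
        have h2 := mem_antidiagonal.mp hij
        have h3 := tt_succ p ij.1 (by omega)
        rw [← mul_assoc y, ← pow_succ']
        congr 1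
        have h4 : chi p (2 * N) = chi p (2 * ij.1) * chi p (2 * ij.2) := by
          rw [← AddChar.map_add_eq_mul, ← h2]
          congr 1; push_cast; ring
        field_simp
        linear_combination chi p (2 * ij.2) * tt p ij.2 * h3
          - dd p ^ 2 * tt p ij.1 * tt p ij.2 * h4
      rw [ih, add_mul, smul_add, Finset.mul_sum, Finset.mul_sum, Finset.smul_sum, Finset.smul_sum,
        Finset.smul_sum]
      have hA' : ∑ ij ∈ antidiagonal N, chi p (2 * N) • (x * (tt p ij.1 * tt p ij.2) •
          (y ^ ij.1 * x ^ ij.2)) = ∑ ij ∈ antidiagonal N, (chi p (2 * N) * tt p ij.1 * tt p ij.2) •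
            (x * (y ^ ij.1 * x ^ ij.2)) := by
        refine Finset.sum_congr rfl fun ij _ => ?_
        rw [mul_smul_comm, smul_smul, mul_assoc]
      have hB' : ∑ ij ∈ antidiagonal N, chi p (2 * N) • (y * (tt p ij.1 * tt p ij.2) •
          (y ^ ij.1 * x ^ ij.2)) = ∑ ij ∈ antidiagonal N, (chi p (2 * N) * tt p ij.1 * tt p ij.2) •
            (y * (y ^ ij.1 * x ^ ij.2)) := by
        refine Finset.sum_congr rfl fun ij _ => ?_
        rw [mul_smul_comm, smul_smul, mul_assoc]
      rw [hA', hB', ← hA, ← hB, ← Finset.sum_add_distrib]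
      refine Finset.sum_congr rfl fun ij hij => ?_
      rw [← add_smul, smul_smul, ← mem_antidiagonal.mp hij, sg_add]
      congr 1
      ring
    have h5 : tt p (N + 1) • (x + y) ^ (N + 1) = (dd p ^ 2 / sg p (N + 1)) •
        ((chi p (2 * N)) • ((x + y) * (tt p N • (x + y) ^ N))) := by
      rw [mul_smul_comm, ← pow_succ', smul_smul, smul_smul]
      congr 1
      field_simp
      linear_combination h1
    rw [h5, key, smul_smul]
    convert one_smul ℂ _
    field_simp

lemma sum_antidiag {M : Type*} [AddCommMonoid M] (F : ℕ → ℕ → M)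
    (hF : ∀ i j, p ≤ i + j → F i j = 0) :
    ∑ m ∈ range p, ∑ ij ∈ antidiagonal m, F ij.1 ij.2 =
      ∑ i ∈ range p, ∑ j ∈ range p, F i j := by
  rw [← Finset.sum_product' (range p) (range p) F]
  have h1 : ∑ x ∈ range p ×ˢ range p, F x.1 x.2 =
      ∑ x ∈ (range p ×ˢ range p).filter (fun x => x.1 + x.2 < p), F x.1 x.2 := by
    symm
    refine Finset.sum_subset (filter_subset _ _) fun x hx hx' => ?_
    apply hF
    by_contra h
    exact hx' (mem_filter.mpr ⟨hx, by omega⟩)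
  rw [h1, ← Finset.sum_fiberwise_of_maps_to (t := range p) (g := fun x : ℕ × ℕ => x.1 + x.2)]
  · refine Finset.sum_congr rfl fun m hm => Finset.sum_congr ?_ fun _ _ => rfl
    have := mem_range.mp hm
    ext ⟨i, j⟩
    simp only [HasAntidiagonal.mem_antidiagonal, mem_filter, mem_product, mem_range]
    omega
  · intro x hx
    exact mem_range.mpr (mem_filter.mp hx).2

/-! ### forms of the `R`-matrix -/

lemma Rmat_eq0 : Rmat p = (4 * (p : ℂ))⁻¹ • ∑ m ∈ range p, ∑ n, ∑ j,
    (tt p m * chi p (-(n * j))) • ((kz p n * De p ^ m) ⊗ₜ[ℂ] (kz p j * Dphi p ^ m)) := by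
  rw [Rmat]
  congr 1
  refine Finset.sum_congr rfl fun m _ => ?_
  rw [sum_zmod_eq_range]
  refine Finset.sum_congr rfl fun n _ => ?_
  rw [sum_zmod_eq_range]
  refine Finset.sum_congr rfl fun j _ => ?_
  rw [← chi_int, ← kz_nat, ← kz_nat, e_pow_kz, phi_pow_kz, ← TensorProduct.smul_tmul',
    TensorProduct.tmul_smul, smul_smul, smul_smul, tt, cc, dd]
  congr 1
  simp only [mul_assoc, ← AddChar.map_add_eq_mul]
  congr 2
  push_cast
  ring

lemma Rmat_eq1 : Rmat p = ∑ m ∈ range p, ∑ a,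
    tt p m • ((Id p a * De p ^ m) ⊗ₜ[ℂ] (kz p a * Dphi p ^ m)) := by
  rw [Rmat_eq0, Finset.smul_sum]
  refine Finset.sum_congr rfl fun m _ => ?_
  rw [Finset.sum_comm, Finset.smul_sum]
  refine Finset.sum_congr rfl fun a _ => ?_
  rw [Id, smul_mul_assoc, ← TensorProduct.smul_tmul', Finset.sum_mul, TensorProduct.sum_tmul,
    Finset.smul_sum, Finset.smul_sum, Finset.smul_sum]
  refine Finset.sum_congr rfl fun n _ => ?_
  rw [smul_mul_assoc, ← TensorProduct.smul_tmul', smul_smul, smul_smul, smul_smul, mul_comm a n]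
  congr 1
  ring

lemma Rmat_eq2 : Rmat p = ∑ m ∈ range p, ∑ b,
    tt p m • ((kz p b * De p ^ m) ⊗ₜ[ℂ] (Id p b * Dphi p ^ m)) := by
  rw [Rmat_eq0, Finset.smul_sum]
  refine Finset.sum_congr rfl fun m _ => ?_
  rw [Finset.smul_sum]
  refine Finset.sum_congr rfl fun a _ => ?_
  rw [Id, smul_mul_assoc, TensorProduct.tmul_smul, Finset.sum_mul, TensorProduct.tmul_sum,
    Finset.smul_sum, Finset.smul_sum, Finset.smul_sum]
  refine Finset.sum_congr rfl fun n _ => ?_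
  rw [smul_mul_assoc, TensorProduct.tmul_smul, smul_smul, smul_smul, smul_smul]
  congr 1
  ring

/-- Cartan part of the `R`-matrix. -/
def Hm : Dq p ⊗[ℂ] Dq p := ∑ a, Id p a ⊗ₜ[ℂ] kz p a

/-- Unipotent part of the `R`-matrix. -/
def Em : Dq p ⊗[ℂ] Dq p := ∑ m ∈ range p, tt p m • ((De p ^ m) ⊗ₜ[ℂ] (Dphi p ^ m))

lemma Rmat_HE : Rmat p = Hm p * Em p := by
  rw [Rmat_eq1, Hm, Em, Finset.mul_sum]
  refine Finset.sum_congr rfl fun m _ => ?_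
  rw [Finset.sum_mul]
  refine Finset.sum_congr rfl fun a _ => ?_
  rw [mul_smul_comm, Algebra.TensorProduct.tmul_mul_tmul]

lemma e_kz (a : ZMod (4 * p)) : De p * kz p a = chi p (-(2 * a)) • (kz p a * De p) := by
  simpa using e_pow_kz p a 1

lemma phi_kz (a : ZMod (4 * p)) : Dphi p * kz p a = chi p (2 * a) • (kz p a * Dphi p) := by
  simpa using phi_pow_kz p a 1

lemma e_Id (a : ZMod (4 * p)) : De p * Id p a = Id p (a + 2) * De p := by
  simpa using e_pow_Id p a 1

lemma phi_Id (a : ZMod (4 * p)) : Dphi p * Id p a = Id p (a - 2) * Dphi p := by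
  simpa using phi_pow_Id p a 1

lemma Hm1 : (De p ⊗ₜ[ℂ] (1 : Dq p)) * Hm p = Hm p * (De p ⊗ₜ[ℂ] kz p (-2)) := by
  rw [Hm, Finset.mul_sum, Finset.sum_mul]
  refine Fintype.sum_equiv (Equiv.addRight 2) _ _ fun a => ?_
  simp only [Equiv.coe_addRight, Algebra.TensorProduct.tmul_mul_tmul, one_mul, e_Id, ← kz_add]
  congr 2; ring

lemma Hm2 : (kz p 2 ⊗ₜ[ℂ] De p) * Hm p = Hm p * ((1 : Dq p) ⊗ₜ[ℂ] De p) := by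
  rw [Hm, Finset.mul_sum, Finset.sum_mul]
  refine Finset.sum_congr rfl fun a _ => ?_
  rw [Algebra.TensorProduct.tmul_mul_tmul, Algebra.TensorProduct.tmul_mul_tmul, kz_Id, e_kz,
    mul_one, ← TensorProduct.smul_tmul', TensorProduct.tmul_smul, smul_smul,
    ← AddChar.map_add_eq_mul, mul_comm a, add_neg_cancel, AddChar.map_zero_eq_one, one_smul]

lemma Hm3 : (Dphi p ⊗ₜ[ℂ] kz p (-2)) * Hm p = Hm p * (Dphi p ⊗ₜ[ℂ] (1 : Dq p)) := by
  rw [Hm, Finset.mul_sum, Finset.sum_mul]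
  refine Fintype.sum_equiv (Equiv.addRight (-2)) _ _ fun a => ?_
  simp only [Equiv.coe_addRight, Algebra.TensorProduct.tmul_mul_tmul, mul_one, phi_Id, ← kz_add]
  rw [sub_eq_add_neg, add_comm (-2) a]

lemma Hm4 : ((1 : Dq p) ⊗ₜ[ℂ] Dphi p) * Hm p = Hm p * (kz p 2 ⊗ₜ[ℂ] Dphi p) := by
  rw [Hm, Finset.mul_sum, Finset.sum_mul]
  refine Finset.sum_congr rfl fun a _ => ?_
  rw [Algebra.TensorProduct.tmul_mul_tmul, Algebra.TensorProduct.tmul_mul_tmul, Id_kz, phi_kz,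
    one_mul, ← TensorProduct.smul_tmul', TensorProduct.tmul_smul, mul_comm a]

lemma Hm5 (b : ZMod (4 * p)) : (kz p b ⊗ₜ[ℂ] kz p b) * Hm p = Hm p * (kz p b ⊗ₜ[ℂ] kz p b) := by
  rw [Hm, Finset.mul_sum, Finset.sum_mul]
  refine Finset.sum_congr rfl fun a _ => ?_
  rw [Algebra.TensorProduct.tmul_mul_tmul, Algebra.TensorProduct.tmul_mul_tmul, Id_kz, kz_Id,
    kz_comm]

lemma Em5 (b : ZMod (4 * p)) : (kz p b ⊗ₜ[ℂ] kz p b) * Em p = Em p * (kz p b ⊗ₜ[ℂ] kz p b) := by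
  rw [Em, Finset.mul_sum, Finset.sum_mul]
  refine Finset.sum_congr rfl fun m _ => ?_
  rw [mul_smul_comm, smul_mul_assoc, Algebra.TensorProduct.tmul_mul_tmul,
    Algebra.TensorProduct.tmul_mul_tmul, kz_e_pow, kz_phi_pow,
    ← TensorProduct.smul_tmul', TensorProduct.tmul_smul, smul_smul (chi p _),
    ← AddChar.map_add_eq_mul, add_neg_cancel, AddChar.map_zero_eq_one, one_smul]

lemma chi_HH (m : ZMod (4 * p)) :
    chi p (2 * m) • HH p (-(2 * m)) = kz p 2 - chi p (4 * m) • kz p (-2) := by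
  rw [HH, smul_sub, smul_smul, smul_smul, ← AddChar.map_add_eq_mul, ← AddChar.map_add_eq_mul,
    add_neg_cancel, AddChar.map_zero_eq_one, one_smul]
  congr 3; ring

lemma tt_coef (m : ℕ) (h : m + 1 < p) :
    tt p (m + 1) * (sg p (m + 1) / dd p ^ 2) = tt p m * chi p (2 * m) := by
  have h1 := tt_succ p m h
  have hd := dd_ne p
  field_simp
  linear_combination h1

lemma sum_helper {M : Type*} [AddCommMonoid M] (a b c d : ℕ → M) (hb : b (p - 1) = 0)
    (hc : c (p - 1) = 0) (h0 : a 0 = d 0)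
    (h : ∀ m, m + 1 < p → a (m + 1) + b m = c m + d (m + 1)) :
    ∑ m ∈ range p, a m + ∑ m ∈ range p, b m = ∑ m ∈ range p, c m + ∑ m ∈ range p, d m := by
  rw [sum_range_pred' p a, sum_range_pred' p d, sum_range_pred p b, sum_range_pred p c, hb, hc, h0,
    add_zero, add_zero, add_right_comm, ← add_assoc, ← Finset.sum_add_distrib,
    ← Finset.sum_add_distrib]
  congr 1
  refine Finset.sum_congr rfl fun m hm => h m ?_
  have := mem_range.mp hm
  omega

lemma chi_HH' (m : ZMod (4 * p)) :
    kz p 2 = chi p (2 * m) • HH p (-(2 * m)) + chi p (4 * m) • kz p (-2) := by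
  rw [chi_HH, sub_add_cancel]

lemma add_perm {M : Type*} [AddCommMonoid M] (A B C : M) : A + (B + C) = C + (A + B) := by
  rw [← add_assoc, add_comm]

lemma Em_e : Em p * ((1 : Dq p) ⊗ₜ[ℂ] De p + De p ⊗ₜ[ℂ] kz p 2) =
    (De p ⊗ₜ[ℂ] kz p (-2) + (1 : Dq p) ⊗ₜ[ℂ] De p) * Em p := by
  have hp0 := hp.out
  have h3 : De p ^ (p - 1 + 1) = 0 := by rw [show p - 1 + 1 = p by omega, De_pow]
  rw [mul_add, add_mul]
  simp only [Em, Finset.sum_mul, Finset.mul_sum, mul_smul_comm, smul_mul_assoc,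
    Algebra.TensorProduct.tmul_mul_tmul, one_mul, mul_one, ← pow_succ, ← pow_succ']
  refine sum_helper (M := Dq p ⊗[ℂ] Dq p) p _ _ _ _ ?_ ?_ ?_ fun m hm => ?_
  · rw [h3, TensorProduct.zero_tmul, smul_zero]
  · rw [h3, TensorProduct.zero_tmul, smul_zero]
  · simp only [pow_zero, one_mul, mul_one]
  · rw [e_phi_pow, TensorProduct.tmul_add, smul_add, TensorProduct.tmul_smul, smul_smul,
      tt_coef p m hm, mul_smul, kz_phi_pow, chi_HH' p m, mul_add, mul_smul_comm, mul_smul_comm,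
      TensorProduct.tmul_add, smul_add, TensorProduct.tmul_smul, TensorProduct.tmul_smul,
      TensorProduct.tmul_smul, show (-(2 * -2 * m) : ZMod (4 * p)) = 4 * m by ring]
    exact add_perm (M := Dq p ⊗[ℂ] Dq p) _ _ _

lemma Em_phi : Em p * (kz p (-2) ⊗ₜ[ℂ] Dphi p + Dphi p ⊗ₜ[ℂ] (1 : Dq p)) =
    (Dphi p ⊗ₜ[ℂ] (1 : Dq p) + kz p 2 ⊗ₜ[ℂ] Dphi p) * Em p := by
  have hp0 := hp.out
  have h3 : Dphi p ^ (p - 1 + 1) = 0 := by rw [show p - 1 + 1 = p by omega, Dphi_pow]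
  rw [mul_add, add_mul]
  simp only [Em, Finset.sum_mul, Finset.mul_sum, mul_smul_comm, smul_mul_assoc,
    Algebra.TensorProduct.tmul_mul_tmul, one_mul, mul_one, ← pow_succ, ← pow_succ']
  symm
  refine (sum_helper (M := Dq p ⊗[ℂ] Dq p) p _ _ _ _ ?_ ?_ ?_ fun m hm => ?_)
  · rw [h3, TensorProduct.tmul_zero, smul_zero]
  · rw [h3, TensorProduct.tmul_zero, smul_zero]
  · simp only [pow_zero, one_mul, mul_one]
  · rw [e_pow_phi, TensorProduct.add_tmul, smul_add, ← TensorProduct.smul_tmul', smul_smul,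
      tt_coef p m hm, mul_smul, e_pow_kz, chi_HH' p m, add_mul, smul_mul_assoc, smul_mul_assoc,
      TensorProduct.add_tmul, smul_add, ← TensorProduct.smul_tmul', ← TensorProduct.smul_tmul',
      ← TensorProduct.smul_tmul', show (-(2 * -2 * m) : ZMod (4 * p)) = 4 * m by ring]
    exact add_perm (M := Dq p ⊗[ℂ] Dq p) _ _ _

/-! ### Properties depending on the coproduct -/

lemma quasi_cocomm (Δ : Dq p →ₐ[ℂ] Dq p ⊗[ℂ] Dq p) (hΔ : IsDeltaD p Δ) (x : Dq p) :
    Rmat p * Δ x = TensorProduct.comm ℂ (Dq p) (Dq p) (Δ x) * Rmat p := by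
  obtain ⟨h1, h2, h3, h4⟩ := hΔ
  induction x using Dq_induction with
  | hC c =>
    rw [AlgHom.commutes, Algebra.TensorProduct.algebraMap_apply, TensorProduct.comm_tmul,
      ← Algebra.TensorProduct.algebraMap_apply', ← Algebra.TensorProduct.algebraMap_apply]
    exact (Algebra.commutes c _).symm
  | he =>
    rw [h1, map_add, TensorProduct.comm_tmul, TensorProduct.comm_tmul, ← kz_two, Rmat_HE,
      mul_assoc, Em_e, add_mul, mul_add, add_mul, ← mul_assoc, ← mul_assoc, ← mul_assoc,
      ← mul_assoc, Hm1, Hm2]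
  | hphi =>
    rw [h2, map_add, TensorProduct.comm_tmul, TensorProduct.comm_tmul, ← kz_neg_two, Rmat_HE,
      mul_assoc, Em_phi, add_mul, mul_add, add_mul, ← mul_assoc, ← mul_assoc, ← mul_assoc,
      ← mul_assoc, Hm3, Hm4, add_comm]
  | hk =>
    rw [h3, TensorProduct.comm_tmul, ← kz_one, Rmat_HE, mul_assoc, ← Em5, ← mul_assoc, ← Hm5,
      mul_assoc]
  | hkinv =>
    rw [h4, TensorProduct.comm_tmul, ← kz_neg_one, Rmat_HE, mul_assoc, ← Em5, ← mul_assoc, ← Hm5,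
      mul_assoc]
  | hadd x y hx hy => rw [map_add, mul_add, hx, hy, map_add, add_mul]
  | hmul x y hx hy =>
    rw [map_mul, comm_mul', ← mul_assoc, hx, mul_assoc, hy, mul_assoc]

lemma Delta_kz (Δ : Dq p →ₐ[ℂ] Dq p ⊗[ℂ] Dq p) (hΔ : IsDeltaD p Δ) (a : ZMod (4 * p)) :
    Δ (kz p a) = kz p a ⊗ₜ[ℂ] kz p a := by
  rw [kz, map_pow, hΔ.2.2.1, Algebra.TensorProduct.tmul_pow]

lemma kz_pow (a : ZMod (4 * p)) (m : ℕ) : kz p a ^ m = kz p (a * m) := by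
  induction m with
  | zero => simp [kz_zero]
  | succ m ih => rw [pow_succ, ih, ← kz_add]; congr 1; push_cast; ring

lemma qbinom_D (x y : Dq p ⊗[ℂ] Dq p) (hyx : y * x = chi p 4 • (x * y))
    (N : ℕ) (hN : N < p) : tt p N • (x + y) ^ N =
      ∑ ij ∈ antidiagonal N, (tt p ij.1 * tt p ij.2) • (y ^ ij.1 * x ^ ij.2) :=
  qbinom p x y hyx N hN

lemma T3_sum_mul {ι : Type*} (s : Finset ι) (f : ι → (Dq p ⊗[ℂ] Dq p) ⊗[ℂ] Dq p)
    (a : (Dq p ⊗[ℂ] Dq p) ⊗[ℂ] Dq p) : (∑ i ∈ s, f i) * a = ∑ i ∈ s, f i * a :=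
  Finset.sum_mul s f a

lemma T3_mul_sum {ι : Type*} (s : Finset ι) (f : ι → (Dq p ⊗[ℂ] Dq p) ⊗[ℂ] Dq p)
    (a : (Dq p ⊗[ℂ] Dq p) ⊗[ℂ] Dq p) : a * (∑ i ∈ s, f i) = ∑ i ∈ s, a * f i :=
  Finset.mul_sum s f a

lemma Delta_e_pow (Δ : Dq p →ₐ[ℂ] Dq p ⊗[ℂ] Dq p) (hΔ : IsDeltaD p Δ) (m : ℕ) (hm : m < p) :
    tt p m • Δ (De p ^ m) = ∑ ij ∈ antidiagonal m, (tt p ij.1 * tt p ij.2) •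
      ((De p ^ ij.1) ⊗ₜ[ℂ] (kz p (2 * ij.1) * De p ^ ij.2)) := by
  rw [map_pow, hΔ.1, qbinom_D p _ _ ?_ m hm]
  · refine Finset.sum_congr rfl fun ij _ => ?_
    rw [Algebra.TensorProduct.tmul_pow, Algebra.TensorProduct.tmul_pow,
      Algebra.TensorProduct.tmul_mul_tmul, ← kz_two, kz_pow, one_pow, mul_one]
  · rw [Algebra.TensorProduct.tmul_mul_tmul, Algebra.TensorProduct.tmul_mul_tmul, ← kz_two, kz_e,
      mul_one, one_mul, TensorProduct.tmul_smul]
    norm_num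

lemma Delta_phi_pow (Δ : Dq p →ₐ[ℂ] Dq p ⊗[ℂ] Dq p) (hΔ : IsDeltaD p Δ) (m : ℕ) (hm : m < p) :
    tt p m • Δ (Dphi p ^ m) = ∑ ij ∈ antidiagonal m, (tt p ij.1 * tt p ij.2) •
      ((kz p (-(2 * ij.1)) * Dphi p ^ ij.2) ⊗ₜ[ℂ] (Dphi p ^ ij.1)) := by
  rw [map_pow, hΔ.2.1, add_comm, qbinom_D p _ _ ?_ m hm]
  · refine Finset.sum_congr rfl fun ij _ => ?_
    rw [Algebra.TensorProduct.tmul_pow, Algebra.TensorProduct.tmul_pow,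
      Algebra.TensorProduct.tmul_mul_tmul, ← kz_neg_two, kz_pow, one_pow, mul_one, neg_mul]
  · rw [Algebra.TensorProduct.tmul_mul_tmul, Algebra.TensorProduct.tmul_mul_tmul, ← kz_neg_two,
      kz_phi, mul_one, one_mul, ← TensorProduct.smul_tmul']
    norm_num

/-- `x ⊗ y ↦ x ⊗ 1 ⊗ y`. -/
def j13 : Dq p ⊗[ℂ] Dq p →ₗ[ℂ] (Dq p ⊗[ℂ] Dq p) ⊗[ℂ] Dq p :=
  TensorProduct.map (e1 p) LinearMap.id

/-- `x ⊗ y ↦ 1 ⊗ x ⊗ y`. -/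
def j23 : Dq p ⊗[ℂ] Dq p →ₗ[ℂ] (Dq p ⊗[ℂ] Dq p) ⊗[ℂ] Dq p :=
  TensorProduct.map (e2 p) LinearMap.id

lemma j13_tmul (x y : Dq p) : j13 p (x ⊗ₜ[ℂ] y) = (x ⊗ₜ[ℂ] 1) ⊗ₜ[ℂ] y := rfl

lemma j23_tmul (x y : Dq p) : j23 p (x ⊗ₜ[ℂ] y) = (1 ⊗ₜ[ℂ] x) ⊗ₜ[ℂ] y := rfl

lemma Delta_id_R (Δ : Dq p →ₐ[ℂ] Dq p ⊗[ℂ] Dq p) (hΔ : IsDeltaD p Δ) :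
    TensorProduct.map Δ.toLinearMap LinearMap.id (Rmat p) = j13 p (Rmat p) * j23 p (Rmat p) := by
  have hL : TensorProduct.map Δ.toLinearMap LinearMap.id (Rmat p) =
      ∑ m ∈ range p, ∑ ij ∈ antidiagonal m, ∑ b, (tt p ij.1 * tt p ij.2) •
        (((kz p b * De p ^ ij.1) ⊗ₜ[ℂ] (kz p (b + 2 * ij.1) * De p ^ ij.2)) ⊗ₜ[ℂ]
          (Id p b * Dphi p ^ (ij.1 + ij.2))) := by
    rw [Rmat_eq2, map_sum]
    refine Finset.sum_congr rfl fun m hm => ?_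
    rw [map_sum, Finset.sum_comm]
    refine Finset.sum_congr rfl fun b _ => ?_
    rw [map_smul, TensorProduct.map_tmul, LinearMap.id_apply, AlgHom.toLinearMap_apply, map_mul,
      Delta_kz p Δ hΔ, TensorProduct.smul_tmul', ← mul_smul_comm,
      Delta_e_pow p Δ hΔ m (mem_range.mp hm), Finset.mul_sum, TensorProduct.sum_tmul]
    refine Finset.sum_congr rfl fun ij hij => ?_
    rw [HasAntidiagonal.mem_antidiagonal.mp hij, mul_smul_comm,
      Algebra.TensorProduct.tmul_mul_tmul, ← TensorProduct.smul_tmul', kz_add, mul_assoc (kz p b)]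
  have hR : j13 p (Rmat p) * j23 p (Rmat p) =
      ∑ i ∈ range p, ∑ j ∈ range p, ∑ b, (tt p i * tt p j) •
        (((kz p b * De p ^ i) ⊗ₜ[ℂ] (kz p (b + 2 * i) * De p ^ j)) ⊗ₜ[ℂ]
          (Id p b * Dphi p ^ (i + j))) := by
    rw [Rmat_eq2, map_sum, map_sum, T3_sum_mul]
    refine Finset.sum_congr rfl fun i _ => ?_
    rw [T3_mul_sum]
    refine Finset.sum_congr rfl fun j _ => ?_
    rw [map_sum, map_sum, T3_sum_mul]
    refine Finset.sum_congr rfl fun b _ => ?_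
    rw [T3_mul_sum, Finset.sum_eq_single (b + 2 * (i : ZMod (4 * p)))]
    · rw [map_smul, map_smul, j13_tmul, j23_tmul, smul_mul_smul_comm,
        Algebra.TensorProduct.tmul_mul_tmul, Algebra.TensorProduct.tmul_mul_tmul, mul_one, one_mul,
        mul_assoc (Id p b), ← mul_assoc (Dphi p ^ i), phi_pow_Id, add_sub_cancel_right,
        ← mul_assoc (Id p b), ← mul_assoc (Id p b), Id_mul, if_pos rfl, mul_assoc, ← pow_add]
    · intro c _ hc
      rw [map_smul, map_smul, j13_tmul, j23_tmul, smul_mul_smul_comm,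
        Algebra.TensorProduct.tmul_mul_tmul,
        mul_assoc (Id p b), ← mul_assoc (Dphi p ^ i), phi_pow_Id,
        ← mul_assoc (Id p b), ← mul_assoc (Id p b), Id_mul, if_neg, zero_mul, zero_mul,
        TensorProduct.tmul_zero, smul_zero]
      intro h
      exact hc (by rw [h]; ring)
    · intro h; exact absurd (mem_univ _) h
  rw [hL, hR]
  refine sum_antidiag p (fun i j => ∑ b, (tt p i * tt p j) •
        (((kz p b * De p ^ i) ⊗ₜ[ℂ] (kz p (b + 2 * i) * De p ^ j)) ⊗ₜ[ℂ]
          (Id p b * Dphi p ^ (i + j)))) fun i j hij => ?_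
  rw [pow_eq_zero_of_le hij (Dphi_pow p)]
  simp

lemma id_Delta_R (Δ : Dq p →ₐ[ℂ] Dq p ⊗[ℂ] Dq p) (hΔ : IsDeltaD p Δ) :
    TensorProduct.map LinearMap.id Δ.toLinearMap (Rmat p) =
      ∑ i ∈ range p, ∑ a, ∑ j ∈ range p, ∑ b,
        (tt p i • (Id p a * De p ^ i) * tt p j • (Id p b * De p ^ j)) ⊗ₜ[ℂ]
          ((kz p b * Dphi p ^ j) ⊗ₜ[ℂ] (kz p a * Dphi p ^ i)) := by
  have hL : TensorProduct.map LinearMap.id Δ.toLinearMap (Rmat p) =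
      ∑ m ∈ range p, ∑ ij ∈ antidiagonal m, ∑ a, (tt p ij.1 * tt p ij.2) •
        ((Id p a * De p ^ (ij.1 + ij.2)) ⊗ₜ[ℂ] ((kz p (a - 2 * ij.1) * Dphi p ^ ij.2) ⊗ₜ[ℂ]
          (kz p a * Dphi p ^ ij.1))) := by
    rw [Rmat_eq1, map_sum]
    refine Finset.sum_congr rfl fun m hm => ?_
    rw [map_sum, Finset.sum_comm]
    refine Finset.sum_congr rfl fun b _ => ?_
    rw [map_smul, TensorProduct.map_tmul, LinearMap.id_apply, AlgHom.toLinearMap_apply, map_mul,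
      Delta_kz p Δ hΔ, ← TensorProduct.tmul_smul, ← mul_smul_comm,
      Delta_phi_pow p Δ hΔ m (mem_range.mp hm), Finset.mul_sum, TensorProduct.tmul_sum]
    refine Finset.sum_congr rfl fun ij hij => ?_
    rw [HasAntidiagonal.mem_antidiagonal.mp hij, mul_smul_comm,
      Algebra.TensorProduct.tmul_mul_tmul, TensorProduct.tmul_smul, sub_eq_add_neg, kz_add,
      mul_assoc (kz p b)]
  rw [hL, sum_antidiag p (fun i j => ∑ a, (tt p i * tt p j) •
        ((Id p a * De p ^ (i + j)) ⊗ₜ[ℂ] ((kz p (a - 2 * i) * Dphi p ^ j) ⊗ₜ[ℂ]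
          (kz p a * Dphi p ^ i))))]
  · refine Finset.sum_congr rfl fun i _ => ?_
    rw [Finset.sum_comm]
    refine Finset.sum_congr rfl fun a _ => ?_
    refine Finset.sum_congr rfl fun j _ => ?_
    symm
    rw [Finset.sum_eq_single (a - 2 * (i : ZMod (4 * p)))]
    · rw [smul_mul_smul_comm, ← TensorProduct.smul_tmul',
        mul_assoc (Id p a), ← mul_assoc (De p ^ i), e_pow_Id, sub_add_cancel,
        ← mul_assoc (Id p a), ← mul_assoc (Id p a), Id_mul, if_pos rfl, mul_assoc (Id p a),
        ← pow_add]
    · intro c _ hc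
      rw [smul_mul_smul_comm,
        mul_assoc (Id p a), ← mul_assoc (De p ^ i), e_pow_Id,
        ← mul_assoc (Id p a), ← mul_assoc (Id p a), Id_mul, if_neg, zero_mul, zero_mul,
        smul_zero, TensorProduct.zero_tmul]
      intro h
      exact hc (by rw [h]; ring)
    · intro h; exact absurd (mem_univ _) h
  · intro i j hij
    rw [pow_eq_zero_of_le hij (De_pow p)]
    simp

end RM
end LogHennings

namespace LogHennings
section Hopf
variable (p : ℕ) [hp : Fact (2 ≤ p)]

/-- First components of the `R`-matrix. -/
def al (i : Fin p × ZMod (4 * p)) : Dq p := tt p i.1 • (Id p i.2 * De p ^ (i.1 : ℕ))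

/-- Second components of the `R`-matrix. -/
def be (i : Fin p × ZMod (4 * p)) : Dq p := kz p i.2 * Dphi p ^ (i.1 : ℕ)

lemma sum_index {M : Type*} [AddCommMonoid M] (f : ℕ → ZMod (4 * p) → M) :
    ∑ i : Fin p × ZMod (4 * p), f i.1 i.2 = ∑ m ∈ range p, ∑ a, f m a := by
  rw [Fintype.sum_prod_type, ← Fin.sum_univ_eq_sum_range (fun m => ∑ a, f m a)]

lemma Rmat_sum : Rmat p = ∑ i, al p i ⊗ₜ[ℂ] be p i := by
  rw [Rmat_eq1, ← sum_index]
  simp only [al, be, TensorProduct.smul_tmul']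

lemma h2_D (Δ : Dq p →ₐ[ℂ] Dq p ⊗[ℂ] Dq p) (hΔ : IsDeltaD p Δ) :
    ∑ i, Δ (al p i) ⊗ₜ[ℂ] be p i =
      ∑ i, ∑ j, (al p i ⊗ₜ[ℂ] al p j) ⊗ₜ[ℂ] (be p i * be p j) := by
  have h := Delta_id_R p Δ hΔ
  rw [Rmat_sum, map_sum, map_sum, map_sum, T3_sum_mul] at h
  simp only [TensorProduct.map_tmul, j13_tmul, j23_tmul, AlgHom.toLinearMap_apply,
    LinearMap.id_apply, T3_mul_sum, Algebra.TensorProduct.tmul_mul_tmul, mul_one, one_mul] at h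
  exact h

lemma h3_D (Δ : Dq p →ₐ[ℂ] Dq p ⊗[ℂ] Dq p) (hΔ : IsDeltaD p Δ) :
    ∑ i, al p i ⊗ₜ[ℂ] Δ (be p i) =
      ∑ i, ∑ j, (al p i * al p j) ⊗ₜ[ℂ] (be p j ⊗ₜ[ℂ] be p i) := by
  have h := id_Delta_R p Δ hΔ
  rw [Rmat_sum, map_sum] at h
  simp only [TensorProduct.map_tmul, AlgHom.toLinearMap_apply, LinearMap.id_apply] at h
  rw [h, ← sum_index p (fun i a => ∑ j ∈ range p, ∑ b,
        (tt p i • (Id p a * De p ^ i) * tt p j • (Id p b * De p ^ j)) ⊗ₜ[ℂ]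
          ((kz p b * Dphi p ^ j) ⊗ₜ[ℂ] (kz p a * Dphi p ^ i)))]
  refine Finset.sum_congr rfl fun i _ => ?_
  rw [← sum_index p (fun j b =>
        (tt p i.1 • (Id p i.2 * De p ^ (i.1 : ℕ)) * tt p j • (Id p b * De p ^ j)) ⊗ₜ[ℂ]
          ((kz p b * Dphi p ^ j) ⊗ₜ[ℂ] (kz p i.2 * Dphi p ^ (i.1 : ℕ))))]
  rfl

variable {p}
lemma D_mul_neg (a b : Dq p) : a * -b = -(a * b) := mul_neg a b
lemma D2_neg_add (a b : Dq p ⊗[ℂ] Dq p) : -(a + b) = -b + -a := neg_add_rev a b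
lemma D_neg_mul (a b : Dq p) : -a * b = -(a * b) := neg_mul a b
lemma D_neg_neg (a : Dq p) : - -a = a := neg_neg a
lemma D_neg_add_cancel (a : Dq p) : -a + a = 0 := neg_add_cancel a
lemma D_add_neg_cancel (a : Dq p) : a + -a = 0 := add_neg_cancel a

variable {S : Dq p →ₗ[ℂ] Dq p} (hS : IsAntipodeD p S)
include hS

lemma S_mul (x y : Dq p) : S (x * y) = S y * S x := hS.2.1 x y

lemma S_alg (c : ℂ) : S (algebraMap ℂ (Dq p) c) = algebraMap ℂ (Dq p) c := by
  rw [Algebra.algebraMap_eq_smul_one, map_smul, hS.1]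

lemma S_pow (x : Dq p) (n : ℕ) : S (x ^ n) = S x ^ n := by
  induction n with
  | zero => rw [pow_zero, pow_zero, hS.1]
  | succ n ih => rw [pow_succ, S_mul hS, ih, pow_succ']

lemma S_kz (a : ZMod (4 * p)) : S (kz p a) = kz p (-a) := by
  rw [kz, S_pow hS, hS.2.2.2.2.1, ← kz_neg_one, kz_pow, ZMod.natCast_zmod_val, neg_one_mul]

lemma S_e : S (De p) = -(De p * kz p (-2)) := by
  rw [hS.2.2.1, kz_neg_two]

lemma S_phi : S (Dphi p) = -(kz p 2 * Dphi p) := by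
  rw [hS.2.2.2.1, kz_two]

omit hS in
lemma kz_cancel (a : ZMod (4 * p)) : kz p a * kz p (-a) = 1 := by
  rw [← kz_add, add_neg_cancel, kz_zero]

omit hS in
lemma kz_cancel' (a : ZMod (4 * p)) : kz p (-a) * kz p a = 1 := by
  rw [← kz_add, neg_add_cancel, kz_zero]

omit hS in
variable (S) in
/-- The inverse antipode. -/
def Si : Dq p →ₗ[ℂ] Dq p :=
  (LinearMap.mulRight ℂ (kz p 2)).comp ((LinearMap.mulLeft ℂ (kz p (-2))).comp S)

omit hS in
lemma Si_apply (x : Dq p) : Si S x = kz p (-2) * S x * kz p 2 := rfl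

lemma Si_mul (x y : Dq p) : Si S (x * y) = Si S y * Si S x := by
  rw [Si_apply, Si_apply, Si_apply, S_mul hS]
  have := kz_cancel (p := p) 2
  calc kz p (-2) * (S y * S x) * kz p 2 = kz p (-2) * S y * 1 * S x * kz p 2 := by
        simp only [mul_assoc, one_mul]
    _ = _ := by rw [← this]; simp only [mul_assoc]

lemma Si_alg (c : ℂ) : Si S (algebraMap ℂ (Dq p) c) = algebraMap ℂ (Dq p) c := by
  rw [Si_apply, S_alg hS, ← Algebra.commutes, mul_assoc, kz_cancel', mul_one]

lemma Si_kz (a : ZMod (4 * p)) : Si S (kz p a) = kz p (-a) := by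
  rw [Si_apply, S_kz hS, ← kz_add, ← kz_add]; congr 1; ring

lemma Si_e : Si S (De p) = -(kz p (-2) * De p) := by
  rw [Si_apply, S_e hS, D_mul_neg, D_neg_mul, ← mul_assoc, mul_assoc _ (kz p (-2)) (kz p 2), kz_cancel',
    mul_one]

lemma Si_phi : Si S (Dphi p) = -(Dphi p * kz p 2) := by
  rw [Si_apply, S_phi hS, D_mul_neg, D_neg_mul, ← mul_assoc, kz_cancel', one_mul]

lemma S_Si (x : Dq p) : S (Si S x) = x := by
  induction x using Dq_induction with
  | hC c => rw [Si_alg hS, S_alg hS]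
  | he => rw [Si_e hS, map_neg, S_mul hS, S_e hS, S_kz hS, D_neg_mul, neg_neg, mul_assoc, neg_neg,
      kz_cancel', mul_one]
  | hphi => rw [Si_phi hS, map_neg, S_mul hS, S_phi hS, S_kz hS, D_mul_neg, neg_neg, ← mul_assoc,
      kz_cancel', one_mul]
  | hk => rw [← kz_one, Si_kz hS, S_kz hS, neg_neg]
  | hkinv => rw [← kz_neg_one, Si_kz hS, S_kz hS, neg_neg]
  | hadd x y hx hy => rw [map_add, map_add, hx, hy]
  | hmul x y hx hy => rw [Si_mul hS, S_mul hS, hx, hy]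

omit hS in
variable (S) in
/-- `x ⊗ y ↦ S⁻¹(y) x`. -/
def T1 : Dq p ⊗[ℂ] Dq p →ₗ[ℂ] Dq p :=
  TensorProduct.lift ((LinearMap.mul ℂ (Dq p)).comp (Si S)).flip

omit hS in
lemma T1_tmul (x y : Dq p) : T1 S (x ⊗ₜ[ℂ] y) = Si S y * x := rfl

omit hS in
variable (S) in
/-- `x ⊗ y ↦ y S⁻¹(x)`. -/
def T2 : Dq p ⊗[ℂ] Dq p →ₗ[ℂ] Dq p :=
  TensorProduct.lift ((LinearMap.mul ℂ (Dq p)).flip.comp (Si S))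

omit hS in
lemma T2_tmul (x y : Dq p) : T2 S (x ⊗ₜ[ℂ] y) = y * Si S x := rfl

omit hS in
variable (S) in
/-- `x ⊗ y ↦ S(x) y`. -/
def T0 : Dq p ⊗[ℂ] Dq p →ₗ[ℂ] Dq p :=
  TensorProduct.lift ((LinearMap.mul ℂ (Dq p)).comp S)

omit hS in
lemma T0_tmul (x y : Dq p) : T0 S (x ⊗ₜ[ℂ] y) = S x * y := rfl

variable {Δ : Dq p →ₐ[ℂ] Dq p ⊗[ℂ] Dq p} (hΔ : IsDeltaD p Δ)
  {ε : Dq p →ₐ[ℂ] ℂ} (hε : IsCounitD p ε)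
include hΔ

omit hS in
lemma Delta_e : Δ (De p) = 1 ⊗ₜ[ℂ] De p + De p ⊗ₜ[ℂ] kz p 2 := by
  rw [hΔ.1, kz_two]

omit hS in
lemma Delta_phi : Δ (Dphi p) = kz p (-2) ⊗ₜ[ℂ] Dphi p + Dphi p ⊗ₜ[ℂ] 1 := by
  rw [hΔ.2.1, kz_neg_two]

include hε

omit hS hΔ in
lemma eps_k : ε (kz p 1) = 1 := by rw [kz_one]; exact hε.2.2.1

omit hS hΔ in
lemma eps_kinv : ε (kz p (-1)) = 1 := by rw [kz_neg_one]; exact hε.2.2.2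

omit hS in
/-- A linear functional absorbing `Δ` of the generators on the left absorbs all of `Δ`. -/
lemma absorb (T : Dq p ⊗[ℂ] Dq p →ₗ[ℂ] Dq p)
    (he : ∀ a b, T (Δ (De p) * (a ⊗ₜ[ℂ] b)) = 0) (hf : ∀ a b, T (Δ (Dphi p) * (a ⊗ₜ[ℂ] b)) = 0)
    (hk : ∀ c : ZMod (4 * p), ∀ a b, T ((kz p c ⊗ₜ[ℂ] kz p c) * (a ⊗ₜ[ℂ] b)) = T (a ⊗ₜ[ℂ] b))
    (x : Dq p) : ∀ w, T (Δ x * w) = ε x • T w := by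
  have hK : ∀ c : ZMod (4 * p), ∀ w, T (Δ (kz p c) * w) = T w := by
    intro c w
    rw [Delta_kz p Δ hΔ]
    induction w using TensorProduct.induction_on with
    | zero => rw [mul_zero]
    | tmul a b => exact hk c a b
    | add u v hu hv => rw [mul_add, map_add, hu, hv, map_add]
  induction x using Dq_induction with
  | hC c =>
    intro w
    rw [AlgHom.commutes, AlgHom.commutes, ← Algebra.smul_def, map_smul]; rfl
  | he =>
    intro w
    rw [hε.1, zero_smul]
    induction w using TensorProduct.induction_on with
    | zero => rw [mul_zero, map_zero]
    | tmul a b => exact he a b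
    | add u v hu hv => rw [mul_add, map_add, hu, hv, add_zero]
  | hphi =>
    intro w
    rw [hε.2.1, zero_smul]
    induction w using TensorProduct.induction_on with
    | zero => rw [mul_zero, map_zero]
    | tmul a b => exact hf a b
    | add u v hu hv => rw [mul_add, map_add, hu, hv, add_zero]
  | hk => intro w; rw [← kz_one, eps_k hε, one_smul, hK]
  | hkinv => intro w; rw [← kz_neg_one, eps_kinv hε, one_smul, hK]
  | hadd x y hx hy => intro w; rw [map_add, add_mul, map_add, hx, hy, map_add, add_smul]
  | hmul x y hx hy => intro w; rw [map_mul Δ, mul_assoc, hx, hy, smul_smul, map_mul ε]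

omit hS in
/-- A linear functional absorbing `Δ` of the generators on the right absorbs all of `Δ`. -/
lemma absorb' (T : Dq p ⊗[ℂ] Dq p →ₗ[ℂ] Dq p)
    (he : ∀ a b, T ((a ⊗ₜ[ℂ] b) * Δ (De p)) = 0) (hf : ∀ a b, T ((a ⊗ₜ[ℂ] b) * Δ (Dphi p)) = 0)
    (hk : ∀ c : ZMod (4 * p), ∀ a b, T ((a ⊗ₜ[ℂ] b) * (kz p c ⊗ₜ[ℂ] kz p c)) = T (a ⊗ₜ[ℂ] b))
    (x : Dq p) : ∀ w, T (w * Δ x) = ε x • T w := by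
  have hK : ∀ c : ZMod (4 * p), ∀ w, T (w * Δ (kz p c)) = T w := by
    intro c w
    rw [Delta_kz p Δ hΔ]
    induction w using TensorProduct.induction_on with
    | zero => rw [zero_mul]
    | tmul a b => exact hk c a b
    | add u v hu hv => rw [add_mul, map_add, hu, hv, map_add]
  induction x using Dq_induction with
  | hC c =>
    intro w
    rw [AlgHom.commutes, AlgHom.commutes, ← Algebra.commutes, ← Algebra.smul_def, map_smul]; rfl
  | he =>
    intro w
    rw [hε.1, zero_smul]
    induction w using TensorProduct.induction_on with
    | zero => rw [zero_mul, map_zero]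
    | tmul a b => exact he a b
    | add u v hu hv => rw [add_mul, map_add, hu, hv, add_zero]
  | hphi =>
    intro w
    rw [hε.2.1, zero_smul]
    induction w using TensorProduct.induction_on with
    | zero => rw [zero_mul, map_zero]
    | tmul a b => exact hf a b
    | add u v hu hv => rw [add_mul, map_add, hu, hv, add_zero]
  | hk => intro w; rw [← kz_one, eps_k hε, one_smul, hK]
  | hkinv => intro w; rw [← kz_neg_one, eps_kinv hε, one_smul, hK]
  | hadd x y hx hy => intro w; rw [map_add, mul_add, map_add, hx, hy, map_add, add_smul]
  | hmul x y hx hy =>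
    intro w; rw [map_mul Δ, ← mul_assoc, hy, hx, smul_smul, map_mul ε, mul_comm]

lemma T1_Delta (x : Dq p) (w) : T1 S (Δ x * w) = ε x • T1 S w := by
  refine absorb hΔ hε (T1 S) ?_ ?_ ?_ x w
  · intro a b
    rw [Delta_e hΔ, add_mul, Algebra.TensorProduct.tmul_mul_tmul,
      Algebra.TensorProduct.tmul_mul_tmul, map_add, T1_tmul, T1_tmul, Si_mul hS, Si_mul hS,
      Si_e hS, Si_kz hS, one_mul]
    simp only [D_mul_neg, D_neg_mul, mul_assoc, D_neg_add_cancel]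
  · intro a b
    rw [Delta_phi hΔ, add_mul, Algebra.TensorProduct.tmul_mul_tmul,
      Algebra.TensorProduct.tmul_mul_tmul, map_add, T1_tmul, T1_tmul, Si_mul hS,
      Si_phi hS, one_mul, D_mul_neg, D_neg_mul, mul_assoc, mul_assoc, ← mul_assoc (kz p 2), kz_cancel,
      one_mul, D_neg_add_cancel]
  · intro c a b
    rw [Algebra.TensorProduct.tmul_mul_tmul, T1_tmul, T1_tmul, Si_mul hS, Si_kz hS, mul_assoc,
      ← mul_assoc (kz p (-c)), kz_cancel', one_mul]

lemma T0_Delta (x : Dq p) (w) : T0 S (Δ x * w) = ε x • T0 S w := by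
  refine absorb hΔ hε (T0 S) ?_ ?_ ?_ x w
  · intro a b
    rw [Delta_e hΔ, add_mul, Algebra.TensorProduct.tmul_mul_tmul,
      Algebra.TensorProduct.tmul_mul_tmul, map_add, T0_tmul, T0_tmul, S_mul hS,
      S_mul hS, hS.1, mul_one, S_e hS, D_mul_neg, D_neg_mul, mul_assoc (S a) (De p * kz p (-2)),
      mul_assoc (De p), ← mul_assoc (kz p (-2)), kz_cancel', one_mul, D_add_neg_cancel]
  · intro a b
    rw [Delta_phi hΔ, add_mul, Algebra.TensorProduct.tmul_mul_tmul,
      Algebra.TensorProduct.tmul_mul_tmul, map_add, T0_tmul, T0_tmul, S_mul hS, S_mul hS,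
      S_phi hS, S_kz hS, one_mul, neg_neg, D_mul_neg, D_neg_mul]
    simp only [mul_assoc, D_add_neg_cancel]
  · intro c a b
    rw [Algebra.TensorProduct.tmul_mul_tmul, T0_tmul, T0_tmul, S_mul hS, S_kz hS, mul_assoc,
      ← mul_assoc (kz p (-c)), kz_cancel', one_mul]

lemma T2_Delta (x : Dq p) (w) : T2 S (w * Δ x) = ε x • T2 S w := by
  refine absorb' hΔ hε (T2 S) ?_ ?_ ?_ x w
  · intro a b
    rw [Delta_e hΔ, mul_add, Algebra.TensorProduct.tmul_mul_tmul,
      Algebra.TensorProduct.tmul_mul_tmul, map_add, T2_tmul, T2_tmul, mul_one, Si_mul hS,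
      Si_e hS, D_neg_mul, D_mul_neg, mul_assoc b (kz p 2), mul_assoc (kz p (-2)),
      ← mul_assoc (kz p 2), kz_cancel, one_mul, mul_assoc, D_add_neg_cancel]
  · intro a b
    rw [Delta_phi hΔ, mul_add, Algebra.TensorProduct.tmul_mul_tmul,
      Algebra.TensorProduct.tmul_mul_tmul, map_add, T2_tmul, T2_tmul, Si_mul hS, Si_mul hS,
      Si_phi hS, Si_kz hS, mul_one, neg_neg]
    simp only [D_mul_neg, D_neg_mul, mul_assoc, D_add_neg_cancel]
  · intro c a b
    rw [Algebra.TensorProduct.tmul_mul_tmul, T2_tmul, T2_tmul, Si_mul hS, Si_kz hS, mul_assoc,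
      ← mul_assoc (kz p c), kz_cancel, one_mul]

omit hS hΔ in
lemma eps_kz (a : ZMod (4 * p)) : ε (kz p a) = 1 := by
  rw [kz, map_pow, hε.2.2.1, one_pow]

omit hS hΔ in
lemma sum_eps_be : ∑ i, ε (be p i) • al p i = 1 := by
  have hp0 := hp.out
  have h := sum_index p (fun m a => ε (kz p a * Dphi p ^ m) • (tt p m • (Id p a * De p ^ m)))
  refine h.trans ?_
  rw [Finset.sum_eq_single 0]
  · simp only [pow_zero, mul_one, eps_kz hε, tt_zero, one_smul, sum_Id]
  · intro m _ hm
    simp [hε.2.1, hm]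
  · intro h
    exact absurd (mem_range.mpr (by omega)) h

omit hΔ hε in
/-- The inverse of the `R`-matrix. -/
lemma Ri_R (hΔ : IsDeltaD p Δ) (hε : IsCounitD p ε) :
    (∑ i, al p i ⊗ₜ[ℂ] Si S (be p i)) * (∑ i, al p i ⊗ₜ[ℂ] be p i) = 1 := by
  have h := congrArg (TensorProduct.map LinearMap.id (T1 S)) (h3_D p Δ hΔ)
  simp only [map_sum, TensorProduct.map_tmul, LinearMap.id_apply, T1_tmul] at h
  rw [Finset.sum_mul]
  simp only [Finset.mul_sum, Algebra.TensorProduct.tmul_mul_tmul]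
  rw [← h]
  have h' : ∀ x, T1 S (Δ x) = ε x • 1 := by
    intro x
    have := T1_Delta hS hΔ hε x 1
    rw [mul_one] at this
    rw [this, Algebra.TensorProduct.one_def, T1_tmul, mul_one, ← map_one (algebraMap ℂ (Dq p)),
      Si_alg hS]
  simp only [h', TensorProduct.tmul_smul, TensorProduct.smul_tmul']
  rw [← TensorProduct.sum_tmul, sum_eps_be hε, Algebra.TensorProduct.one_def]

omit hΔ hε in
lemma R_Ri (hΔ : IsDeltaD p Δ) (hε : IsCounitD p ε) :
    (∑ i, al p i ⊗ₜ[ℂ] be p i) * (∑ i, al p i ⊗ₜ[ℂ] Si S (be p i)) = 1 := by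
  have h := congrArg (TensorProduct.map LinearMap.id (T2 S)) (h3_D p Δ hΔ)
  simp only [map_sum, TensorProduct.map_tmul, LinearMap.id_apply, T2_tmul] at h
  rw [Finset.sum_mul]
  simp only [Finset.mul_sum, Algebra.TensorProduct.tmul_mul_tmul]
  rw [← h]
  have h' : ∀ x, T2 S (Δ x) = ε x • 1 := by
    intro x
    have := T2_Delta hS hΔ hε x 1
    rw [one_mul] at this
    rw [this, Algebra.TensorProduct.one_def, T2_tmul, one_mul, ← map_one (algebraMap ℂ (Dq p)),
      Si_alg hS]
  simp only [h', TensorProduct.tmul_smul, TensorProduct.smul_tmul']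
  rw [← TensorProduct.sum_tmul, sum_eps_be hε, Algebra.TensorProduct.one_def]

omit hΔ hε in
lemma hb_D (hΔ : IsDeltaD p Δ) (hε : IsCounitD p ε) :
    ∑ i, ∑ j, (S (be p i) * be p j) ⊗ₜ[ℂ] (al p j * al p i) = (1 : Dq p ⊗[ℂ] Dq p) := by
  have h := Ri_R hS hΔ hε
  rw [Finset.sum_mul] at h
  simp only [Finset.mul_sum, Algebra.TensorProduct.tmul_mul_tmul] at h
  have h2 := congrArg (TensorProduct.comm ℂ (Dq p) (Dq p))
    (congrArg (TensorProduct.map LinearMap.id S) h)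
  rw [Algebra.TensorProduct.one_def] at h2
  simp only [map_sum, TensorProduct.map_tmul, LinearMap.id_apply, TensorProduct.comm_tmul,
    S_mul hS, S_Si hS, hS.1] at h2
  rw [Finset.sum_comm, h2, Algebra.TensorProduct.one_def]

omit hΔ hε in
lemma mapSS_mul (u v : Dq p ⊗[ℂ] Dq p) :
    TensorProduct.map S S (u * v) = TensorProduct.map S S v * TensorProduct.map S S u := by
  induction u using TensorProduct.induction_on with
  | zero => rw [zero_mul, map_zero, mul_zero]
  | add a b ha hb => rw [add_mul, map_add, ha, hb, map_add, mul_add]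
  | tmul a b =>
    induction v using TensorProduct.induction_on with
    | zero => rw [mul_zero, map_zero, zero_mul]
    | add c d hc hd => rw [mul_add, map_add, hc, hd, map_add, add_mul]
    | tmul c d =>
      rw [Algebra.TensorProduct.tmul_mul_tmul, TensorProduct.map_tmul, TensorProduct.map_tmul,
        TensorProduct.map_tmul, Algebra.TensorProduct.tmul_mul_tmul, S_mul hS, S_mul hS]

omit hε in
lemma Delta_S (x : Dq p) :
    Δ (S x) = TensorProduct.map S S (TensorProduct.comm ℂ (Dq p) (Dq p) (Δ x)) := by
  induction x using Dq_induction with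
  | hC c =>
    rw [S_alg hS, AlgHom.commutes, Algebra.TensorProduct.algebraMap_apply, TensorProduct.comm_tmul,
      TensorProduct.map_tmul, S_alg hS, hS.1,
      ← Algebra.TensorProduct.algebraMap_apply', ← Algebra.TensorProduct.algebraMap_apply]
  | he =>
    rw [S_e hS, map_neg, map_mul, Delta_kz p Δ hΔ, Delta_e hΔ, map_add, map_add,
      TensorProduct.comm_tmul, TensorProduct.comm_tmul, TensorProduct.map_tmul,
      TensorProduct.map_tmul, hS.1, S_e hS, S_kz hS, add_mul, Algebra.TensorProduct.tmul_mul_tmul,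
      Algebra.TensorProduct.tmul_mul_tmul, kz_cancel, one_mul, TensorProduct.neg_tmul,
      TensorProduct.tmul_neg]
    exact D2_neg_add _ _
  | hphi =>
    rw [S_phi hS, map_neg, map_mul, Delta_kz p Δ hΔ, Delta_phi hΔ, map_add, map_add,
      TensorProduct.comm_tmul, TensorProduct.comm_tmul, TensorProduct.map_tmul,
      TensorProduct.map_tmul, hS.1, S_phi hS, S_kz hS, mul_add, Algebra.TensorProduct.tmul_mul_tmul,
      Algebra.TensorProduct.tmul_mul_tmul, kz_cancel, mul_one, TensorProduct.neg_tmul,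
      TensorProduct.tmul_neg, neg_neg]
    exact D2_neg_add _ _
  | hk => rw [← kz_one, S_kz hS, Delta_kz p Δ hΔ, Delta_kz p Δ hΔ, TensorProduct.comm_tmul,
      TensorProduct.map_tmul, S_kz hS]
  | hkinv => rw [← kz_neg_one, S_kz hS, Delta_kz p Δ hΔ, Delta_kz p Δ hΔ, TensorProduct.comm_tmul,
      TensorProduct.map_tmul, S_kz hS]
  | hadd x y hx hy => simp only [map_add, hx, hy]
  | hmul x y hx hy => rw [S_mul hS, map_mul, hx, hy, map_mul, comm_mul', mapSS_mul hS]

end Hopf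
end LogHennings

namespace LogHennings
section UU
variable {p : ℕ} [hp : Fact (2 ≤ p)]

lemma D_neg_one_smul (x : Dq p) : (-1 : ℂ) • x = -x := neg_one_smul ℂ x

lemma kphi_step (c : ZMod (4 * p)) (m : ℕ) : kz p c * Dphi p ^ m * (kz p 2 * Dphi p) =
    chi p (2 * 2 * m) • (kz p (c + 2) * Dphi p ^ (m + 1)) := by
  rw [← mul_assoc, mul_assoc (kz p _) _ (kz p 2), phi_pow_kz, mul_smul_comm, smul_mul_assoc,
    ← mul_assoc (kz p c), ← kz_add, mul_assoc (kz p _), ← pow_succ]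

lemma ke_step (c : ZMod (4 * p)) (m : ℕ) : De p ^ m * kz p c * (De p * kz p (-2)) =
    chi p (2 * c) • (De p ^ (m + 1) * kz p (c - 2)) := by
  rw [← mul_assoc, mul_assoc (De p ^ m) (kz p c), kz_e, mul_smul_comm, smul_mul_assoc,
    ← mul_assoc (De p ^ m), ← pow_succ, mul_assoc, ← kz_add, sub_eq_add_neg]

variable {S : Dq p →ₗ[ℂ] Dq p} (hS : IsAntipodeD p S)
include hS

lemma S_phi_pow (m : ℕ) : S (Dphi p) ^ m =
    chi p (2 * p * m + 2 * m * (m - 1)) • (kz p (2 * m) * Dphi p ^ m) := by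
  induction m with
  | zero => simp [kz_zero]
  | succ m ih =>
    have h1 : (-(kz p 2 * Dphi p) : Dq p) = chi p (2 * p) • (kz p 2 * Dphi p) := by
      rw [chi_two_p, D_neg_one_smul]
    rw [pow_succ, ih, S_phi hS, h1, smul_mul_assoc, mul_smul_comm, kphi_step, smul_smul, smul_smul,
      ← AddChar.map_add_eq_mul, ← AddChar.map_add_eq_mul]
    congr 2
    · push_cast; ring
    · push_cast; congr 1; ring

lemma S_e_pow (m : ℕ) : S (De p) ^ m =
    chi p (2 * p * m - 2 * m * (m - 1)) • (De p ^ m * kz p (-(2 * m))) := by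
  induction m with
  | zero => simp [kz_zero]
  | succ m ih =>
    have h1 : (-(De p * kz p (-2)) : Dq p) = chi p (2 * p) • (De p * kz p (-2)) := by
      rw [chi_two_p, D_neg_one_smul]
    rw [pow_succ, ih, S_e hS, h1, smul_mul_assoc, mul_smul_comm, ke_step, smul_smul, smul_smul,
      ← AddChar.map_add_eq_mul, ← AddChar.map_add_eq_mul]
    congr 2
    · push_cast; ring
    · push_cast; congr 1; ring

lemma S_ephi (m : ℕ) : S (De p) ^ m * S (Dphi p) ^ m = De p ^ m * Dphi p ^ m := by
  rw [S_e_pow hS, S_phi_pow hS, smul_mul_assoc, mul_smul_comm, smul_smul, ← mul_assoc,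
    mul_assoc (De p ^ m), kz_cancel', mul_one, ← AddChar.map_add_eq_mul,
    show (2 * p * m - 2 * m * (m - 1) + (2 * p * m + 2 * m * (m - 1)) : ZMod (4 * p)) =
      (4 * p) * m by ring, four_p, zero_mul, AddChar.map_zero_eq_one, one_smul]

lemma S_Id (a : ZMod (4 * p)) : S (Id p a) = Id p (-a) := by
  rw [Id, Id, map_smul, map_sum]
  congr 1
  refine Fintype.sum_equiv (Equiv.neg _) _ _ fun n => ?_
  rw [map_smul, S_kz hS, Equiv.neg_apply, neg_mul_neg]

omit hS in
lemma kz_phie (c b : ZMod (4 * p)) (m : ℕ) : kz p c * Dphi p ^ m * (De p ^ m * Id p b) =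
    chi p (b * c) • (Dphi p ^ m * De p ^ m * Id p b) := by
  rw [kz_phi_pow, smul_mul_assoc, mul_assoc (Dphi p ^ m), ← mul_assoc (kz p c), kz_e_pow, smul_mul_assoc,
    mul_assoc (De p ^ m), kz_Id, mul_smul_comm, mul_smul_comm, mul_smul_comm, smul_smul, smul_smul,
    ← AddChar.map_add_eq_mul, ← AddChar.map_add_eq_mul, ← mul_assoc]
  congr 2; ring

/-- The Drinfeld element is `r g`. -/
lemma u_eq : ∑ i, S (be p i) * al p i = rib p * kz p (2 * p + 2) := by
  have h := sum_index p (fun m a => S (kz p a * Dphi p ^ m) * (tt p m • (Id p a * De p ^ m)))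
  refine h.trans ?_
  rw [rib_eq, Finset.sum_mul]
  refine Finset.sum_congr rfl fun m _ => ?_
  rw [Finset.sum_mul, ← Equiv.sum_comp (Equiv.addRight (2 * m : ZMod (4 * p)))]
  refine Finset.sum_congr rfl fun b _ => ?_
  have h1 : kz p (-(b + 2 * m)) * (Id p (b + 2 * m) * De p ^ m) =
      chi p ((b + 2 * m) * -(b + 2 * m)) • (De p ^ m * Id p b) := by
    rw [← mul_assoc, kz_Id, smul_mul_assoc, e_pow_Id]
  rw [Equiv.coe_addRight, smul_mul_assoc, mul_assoc _ (Id p b), Id_kz, S_mul hS,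
    S_pow hS, S_kz hS, S_phi_pow hS, mul_smul_comm, mul_smul_comm, smul_smul, mul_assoc, h1,
    mul_smul_comm, smul_mul_assoc, kz_phie, smul_smul, smul_smul, smul_smul, tt, ww]
  congr 1
  simp only [mul_assoc (cc p m)]
  congr 1
  simp only [← AddChar.map_add_eq_mul]
  congr 1
  linear_combination (m : ZMod (4 * p)) * four_p p

lemma kz_central (x : Dq p) : kz p (2 * p) * x = x * kz p (2 * p) := by
  have h4 : (2 * (2 * p) : ZMod (4 * p)) = 0 := by rw [← four_p p]; ring
  induction x using Dq_induction with
  | hC c => exact (Algebra.commutes c _).symm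
  | he => rw [kz_e, h4, AddChar.map_zero_eq_one, one_smul]
  | hphi => rw [kz_phi, h4, neg_zero, AddChar.map_zero_eq_one, one_smul]
  | hk => rw [← kz_one, kz_comm]
  | hkinv => rw [← kz_neg_one, kz_comm]
  | hadd x y hx hy => rw [mul_add, hx, hy, add_mul]
  | hmul x y hx hy => rw [← mul_assoc, hx, mul_assoc, hy, mul_assoc]

lemma hu_D (x : Dq p) : S x * (∑ i, S (be p i) * al p i) = (∑ i, S (be p i) * al p i) * Si S x := by
  rw [u_eq hS, Si_apply, ← mul_assoc, ← rib_central, mul_assoc, mul_assoc, kz_add, ← mul_assoc (S x),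
    ← kz_central hS, mul_assoc, mul_assoc, mul_assoc, ← mul_assoc (kz p 2) (kz p (-2)), kz_cancel,
    one_mul]

end UU
end LogHennings

namespace LogHennings
section Srib
open Polynomial
variable (p : ℕ) [hp : Fact (2 ≤ p)]

/-- Eigenvalues of the Casimir element. -/
def nu (b : ZMod (4 * p)) : ℂ := chi p (2 * (b + 1)) + chi p (-(2 * (b + 1)))

/-- Coefficients of the ribbon element in the Casimir expansion. -/
def FF (b : ZMod (4 * p)) (m : ℕ) : ℂ := cc p m * ww p m b * ((dd p ^ 2)⁻¹) ^ m

/-- Products of Casimir factors. -/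
def PP (b : ZMod (4 * p)) (m : ℕ) : ℂ[X] := ∏ t ∈ range m, (X + C (-nu p (b + 2 * t)))

/-- The ribbon element on a weight space, as a polynomial in the Casimir. -/
def NN (b : ZMod (4 * p)) (M : ℕ) : ℂ[X] := ∑ m ∈ range M, C (FF p b m) * PP p b m

lemma FF_rel (b : ZMod (4 * p)) (m : ℕ) (h : m + 1 < p) :
    FF p b (m + 1) * (nu p (b + 2 + 2 * m) - nu p b) = FF p (b + 2) m - FF p b m := by
  have h1 := cc_succ p m h
  have h2 := ww_rel p m b
  have h3 := dd_ne p
  have h4 : nu p (b + 2 + 2 * m) - nu p b = sg p (m + 1) *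
      (chi p (2 * (m + 2 + b)) - chi p (-(2 * (m + 2 + b)))) := by
    rw [sg, nu, nu, mul_sub, sub_mul, sub_mul]
    simp only [← AddChar.map_add_eq_mul]
    have e1 : (2 * (b + 2 + 2 * m + 1) : ZMod (4 * p)) = 2 * ((m + 1 : ℕ) : ZMod (4 * p)) + 2 * (m + 2 + b) := by
      push_cast; ring
    have e2 : (2 * (b + 1) : ZMod (4 * p)) = -(2 * ((m + 1 : ℕ) : ZMod (4 * p))) + 2 * (m + 2 + b) := by
      push_cast; ring
    have e3 : (-(2 * (b + 2 + 2 * m + 1)) : ZMod (4 * p)) = -(2 * ((m + 1 : ℕ) : ZMod (4 * p))) + -(2 * (m + 2 + b)) := by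
      push_cast; ring
    have e4 : (-(2 * (b + 1)) : ZMod (4 * p)) = (2 * ((m + 1 : ℕ) : ZMod (4 * p))) + -(2 * (m + 2 + b)) := by
      push_cast; ring
    rw [e3, e4, e1, e2]
    ring
  rw [h4]
  have h5 : ((dd p ^ 2)⁻¹) ^ (m + 1) * dd p ^ 2 = ((dd p ^ 2)⁻¹) ^ m := by
    rw [pow_succ, mul_assoc, inv_mul_cancel₀ (pow_ne_zero 2 h3), mul_one]
  calc _ = (cc p (m + 1) * sg p (m + 1)) * (ww p (m + 1) b * (chi p (2 * (m + 2 + b)) - chi p (-(2 * (m + 2 + b)))))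
          * ((dd p ^ 2)⁻¹) ^ (m + 1) := by rw [FF]; ring
    _ = cc p m * (ww p m (b + 2) - ww p m b) * (((dd p ^ 2)⁻¹) ^ (m + 1) * dd p ^ 2) := by
      rw [h1, h2]; ring
    _ = _ := by rw [h5, FF, FF]; ring

lemma PP_succ (b : ZMod (4 * p)) (m : ℕ) :
    PP p b (m + 1) = PP p b m * (X + C (-nu p (b + 2 * m))) := by
  rw [PP, Finset.prod_range_succ, PP]

lemma PP_succ' (b : ZMod (4 * p)) (m : ℕ) :
    PP p b (m + 1) = (X + C (-nu p b)) * PP p (b + 2) m := by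
  have h : ∀ t : ℕ, b + 2 * ((t + 1 : ℕ) : ZMod (4 * p)) = b + 2 + 2 * t := by
    intro t; push_cast; ring
  rw [PP, Finset.prod_range_succ', PP, mul_comm]
  simp only [h, Nat.cast_zero, mul_zero, add_zero]

lemma NN_succ (b : ZMod (4 * p)) (M : ℕ) :
    NN p b (M + 1) = NN p b M + C (FF p b M) * PP p b M := by
  rw [NN, Finset.sum_range_succ, NN]

lemma NN_step (b : ZMod (4 * p)) (M : ℕ) (h : M < p) :
    NN p b (M + 1) = NN p (b + 2) M + C (FF p b M) * PP p (b + 2) M := by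
  induction M with
  | zero => simp [NN, PP]
  | succ M ih =>
    have hC := congrArg (C : ℂ → ℂ[X]) (FF_rel p b M h)
    simp only [C_mul, C_sub] at hC
    rw [NN_succ, ih (by omega), NN_succ, PP_succ' p b, PP_succ p (b + 2)]
    simp only [C_neg]
    linear_combination (PP p (b + 2) M) * hC

lemma NN_eq (M : ℕ) (h : M ≤ p) (b : ZMod (4 * p)) :
    NN p b M = ∑ l ∈ range M, C (FF p (b + 2 * (M - 1 - l)) l) * PP p (b + 2 * (M - l)) l := by
  induction M generalizing b with
  | zero => simp [NN]
  | succ M ih =>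
    rw [NN_step p b M h, ih (by omega), Finset.sum_range_succ]
    have e1 : ∀ l : ℕ, b + 2 + 2 * ((M : ZMod (4 * p)) - 1 - l) =
        b + 2 * (((M + 1 : ℕ) : ZMod (4 * p)) - 1 - l) := by intro l; push_cast; ring
    have e2 : ∀ l : ℕ, b + 2 + 2 * ((M : ZMod (4 * p)) - l) =
        b + 2 * (((M + 1 : ℕ) : ZMod (4 * p)) - l) := by intro l; push_cast; ring
    have e3 : b + 2 * (((M + 1 : ℕ) : ZMod (4 * p)) - 1 - M) = b := by push_cast; ring
    have e4 : b + 2 * (((M + 1 : ℕ) : ZMod (4 * p)) - M) = b + 2 := by push_cast; ring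
    rw [e3, e4]
    simp only [e1, e2]

lemma FF_symm (b : ZMod (4 * p)) (l : ℕ) : FF p (b + 2 * (p - 1 - l)) l = FF p (-b) l := by
  rw [FF, FF, ww, ww]
  congr 3
  linear_combination (-2 * (b - 1 - l + p)) * four_p p

lemma nu_symm (b : ZMod (4 * p)) (l t : ℕ) (ht : t < l) :
    nu p (b + 2 * (p - l) + 2 * (l - 1 - t : ℕ)) = nu p (-b + 2 * t) := by
  have e : ((l - 1 - t : ℕ) : ZMod (4 * p)) = l - 1 - t := by
    rw [Nat.sub_sub, Nat.cast_sub (by omega)]; push_cast; ring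
  rw [nu, nu, add_comm, e]
  congr 2
  · linear_combination (-1 : ZMod (4 * p)) * four_p p
  · linear_combination (1 : ZMod (4 * p)) * four_p p

lemma PP_symm (b : ZMod (4 * p)) (l : ℕ) : PP p (b + 2 * (p - l)) l = PP p (-b) l := by
  unfold PP
  rw [← Finset.prod_range_reflect]
  refine Finset.prod_congr rfl fun t ht => ?_
  rw [nu_symm p b l t (mem_range.mp ht)]

lemma NN_symm (b : ZMod (4 * p)) : NN p b p = NN p (-b) p := by
  rw [NN_eq p p le_rfl, NN]
  simp only [FF_symm, PP_symm]

/-- The Casimir element. -/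
def cas : Dq p := dd p ^ 2 • (Dphi p * De p) + (chi p 2 • kz p 2 + chi p (-2) • kz p (-2))

lemma e_phi_cas : cas p =
    dd p ^ 2 • (De p * Dphi p) + (chi p (-2) • kz p 2 + chi p 2 • kz p (-2)) := by
  have h := dd_ne p
  have hd := dd_eq p
  rw [De_phi, ← kz_two, ← kz_neg_two, smul_add, smul_smul, cas, add_assoc]
  congr 1
  rw [pow_two, mul_assoc, mul_inv_cancel₀ h, mul_one, hd]
  module

lemma cas_phi : cas p * Dphi p = Dphi p * cas p := by
  conv_rhs => rw [e_phi_cas]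
  rw [cas]
  simp only [add_mul, mul_add, smul_mul_assoc, mul_smul_comm, kz_phi, smul_smul,
    ← AddChar.map_add_eq_mul, mul_assoc]
  congr 4 <;> ring_nf

lemma cas_e : cas p * De p = De p * cas p := by
  conv_lhs => rw [e_phi_cas]
  rw [cas]
  simp only [add_mul, mul_add, smul_mul_assoc, mul_smul_comm, kz_e, smul_smul,
    ← AddChar.map_add_eq_mul, mul_assoc]
  congr 4 <;> ring_nf

lemma cas_phi_pow (m : ℕ) : cas p * Dphi p ^ m = Dphi p ^ m * cas p :=
  ((show Commute (cas p) (Dphi p) from cas_phi p).pow_right m)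

lemma cas_e_pow (m : ℕ) : cas p * De p ^ m = De p ^ m * cas p :=
  ((show Commute (cas p) (De p) from cas_e p).pow_right m)

lemma phie_Id (b : ZMod (4 * p)) : dd p ^ 2 • (Dphi p * De p * Id p b) =
    cas p * Id p b + (-nu p b) • Id p b := by
  rw [cas, add_mul, add_mul, smul_mul_assoc, smul_mul_assoc, smul_mul_assoc, kz_Id, kz_Id,
    smul_smul, smul_smul, ← AddChar.map_add_eq_mul, ← AddChar.map_add_eq_mul, nu,
    show 2 + b * 2 = 2 * (b + 1) by ring, show -2 + b * -2 = -(2 * (b + 1)) by ring]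
  module

lemma ephi_Id (b : ZMod (4 * p)) : dd p ^ 2 • (De p * Dphi p * Id p b) =
    cas p * Id p b + (-nu p (-b)) • Id p b := by
  rw [e_phi_cas, add_mul, add_mul, smul_mul_assoc, smul_mul_assoc, smul_mul_assoc, kz_Id, kz_Id,
    smul_smul, smul_smul, ← AddChar.map_add_eq_mul, ← AddChar.map_add_eq_mul, nu,
    show -2 + b * 2 = -(2 * (-b + 1)) by ring, show 2 + b * -2 = (2 * (-b + 1)) by ring]
  module

lemma aeval_step (b : ZMod (4 * p)) (c : ℂ) (m : ℕ) (y : Dq p) :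
    aeval (cas p) (PP p b m * (X + C c)) * y =
      aeval (cas p) (PP p b m) * (cas p * y + c • y) := by
  rw [map_mul, map_add, aeval_X, aeval_C, mul_assoc, add_mul, Algebra.smul_def]

lemma phie_pow (b : ZMod (4 * p)) (m : ℕ) :
    (dd p ^ 2) ^ m • (Dphi p ^ m * De p ^ m * Id p b) = aeval (cas p) (PP p b m) * Id p b := by
  induction m with
  | zero => simp [PP]
  | succ m ih =>
    have h := phie_Id p (b + 2 * m)
    have hc : aeval (cas p) (X + C (-nu p (b + 2 * m)) : ℂ[X]) * Dphi p ^ m =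
        Dphi p ^ m * aeval (cas p) (X + C (-nu p (b + 2 * m)) : ℂ[X]) := by
      rw [map_add, aeval_X, aeval_C, add_mul, mul_add, cas_phi_pow, Algebra.commutes]
    rw [PP_succ, mul_comm (PP p b m), map_mul, mul_assoc (aeval (cas p) _), ← ih, mul_smul_comm, pow_succ, mul_smul]
    congr 1
    rw [mul_assoc (Dphi p ^ m), e_pow_Id, ← mul_assoc, hc, mul_assoc, ← mul_assoc _ (Id p _),
      map_add, aeval_X, aeval_C, mul_assoc (Dphi p ^ m), add_mul, ← Algebra.smul_def, ← h,
      mul_smul_comm, smul_mul_assoc, pow_succ (Dphi p), pow_succ' (De p)]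
    simp only [mul_assoc, e_pow_Id]

lemma ephi_pow (b : ZMod (4 * p)) (m : ℕ) :
    (dd p ^ 2) ^ m • (De p ^ m * Dphi p ^ m * Id p b) = aeval (cas p) (PP p (-b) m) * Id p b := by
  induction m with
  | zero => simp [PP]
  | succ m ih =>
    have h := ephi_Id p (b - 2 * m)
    rw [show -(b - 2 * m) = -b + 2 * m by ring] at h
    have hc : aeval (cas p) (X + C (-nu p (-b + 2 * m)) : ℂ[X]) * De p ^ m =
        De p ^ m * aeval (cas p) (X + C (-nu p (-b + 2 * m)) : ℂ[X]) := by
      rw [map_add, aeval_X, aeval_C, add_mul, mul_add, cas_e_pow, Algebra.commutes]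
    rw [PP_succ, mul_comm (PP p (-b) m), map_mul, mul_assoc (aeval (cas p) _), ← ih, mul_smul_comm, pow_succ, mul_smul]
    congr 1
    rw [mul_assoc (De p ^ m), phi_pow_Id, ← mul_assoc, hc, mul_assoc, ← mul_assoc _ (Id p _),
      map_add, aeval_X, aeval_C, mul_assoc (De p ^ m), add_mul, ← Algebra.smul_def, ← h,
      mul_smul_comm, smul_mul_assoc, pow_succ (De p), pow_succ' (Dphi p)]
    simp only [mul_assoc, phi_pow_Id]

lemma FF_smul (b : ZMod (4 * p)) (m : ℕ) (y z : Dq p) (h : (dd p ^ 2) ^ m • y = z) :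
    (cc p m * ww p m b) • y = FF p b m • z := by
  have hd := dd_ne p
  rw [← h, smul_smul, FF, mul_assoc, ← mul_pow, inv_mul_cancel₀ (pow_ne_zero 2 hd), one_pow,
    mul_one]

lemma aeval_NN (b : ZMod (4 * p)) (y : Dq p) : aeval (cas p) (NN p b p) * y =
    ∑ m ∈ range p, FF p b m • (aeval (cas p) (PP p b m) * y) := by
  rw [NN, map_sum, Finset.sum_mul]
  refine Finset.sum_congr rfl fun m _ => ?_
  rw [map_mul, aeval_C, mul_assoc, ← Algebra.smul_def]

lemma rib_NN : rib p = ∑ b, aeval (cas p) (NN p b p) * Id p b := by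
  rw [rib_eq, Finset.sum_comm]
  refine Finset.sum_congr rfl fun b _ => ?_
  rw [aeval_NN]
  exact Finset.sum_congr rfl fun m _ => FF_smul p b m _ _ (phie_pow p b m)

variable {p}
variable {S : Dq p →ₗ[ℂ] Dq p} (hS : IsAntipodeD p S)
include hS

lemma S_rib_NN : S (rib p) = ∑ b, aeval (cas p) (NN p b p) * Id p (-b) := by
  rw [rib_eq, map_sum]
  simp only [map_sum]
  rw [Finset.sum_comm]
  refine Finset.sum_congr rfl fun b _ => ?_
  rw [aeval_NN]
  refine Finset.sum_congr rfl fun m _ => ?_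
  rw [map_smul, S_mul hS, S_mul hS, S_pow hS, S_pow hS, S_ephi hS, S_Id hS]
  have h := ephi_pow p (-b) m
  rw [neg_neg] at h
  refine Eq.trans ?_ (FF_smul p b m _ _ h)
  rw [mul_assoc (De p ^ m), phi_pow_Id, ← mul_assoc (De p ^ m), e_pow_Id, sub_add_cancel, mul_assoc]

lemma S_rib : S (rib p) = rib p := by
  rw [S_rib_NN hS, rib_NN, ← Equiv.sum_comp (Equiv.neg (ZMod (4 * p)))]
  refine Finset.sum_congr rfl fun b _ => ?_
  rw [Equiv.neg_apply, neg_neg, ← NN_symm]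

end Srib
end LogHennings

namespace LogHennings
section Final
variable {p : ℕ} [hp : Fact (2 ≤ p)]

variable (p) in
lemma R21_sum : R21 p = ∑ i, be p i ⊗ₜ[ℂ] al p i := by
  rw [R21, Rmat_sum, map_sum]; rfl

lemma drinfeldU_sum (S : Dq p →ₗ[ℂ] Dq p) : drinfeldU p S = ∑ i, S (be p i) * al p i := by
  rw [drinfeldU, R21_sum, map_sum, map_sum]; rfl

variable (p) in
/-- The balancing element. -/
def gg : Dq p := kz p (2 * p + 2)

variable (p) in
/-- The inverse of the balancing element. -/
def gi : Dq p := kz p (-(2 * p + 2))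

lemma gg_gi : gg p * gi p = 1 := kz_cancel _

theorem ribbon_main (Δ : Dq p →ₐ[ℂ] Dq p ⊗[ℂ] Dq p) (ε : Dq p →ₐ[ℂ] ℂ)
    (S : Dq p →ₗ[ℂ] Dq p) (hΔ : IsDeltaD p Δ) (hε : IsCounitD p ε) (hS : IsAntipodeD p S) :
      IsUnit (rib p) ∧ (∀ x : Dq p, rib p * x = x * rib p) ∧
      rib p ^ 2 = drinfeldU p S * S (drinfeldU p S) ∧
      S (rib p) = rib p ∧ ε (rib p) = 1 ∧
      ∃ Minv : Dq p ⊗[ℂ] Dq p, Mmat p * Minv = 1 ∧ Minv * Mmat p = 1 ∧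
        Δ (rib p) = Minv * (rib p ⊗ₜ[ℂ] rib p) := by
  have hc := rib_central p
  have hSr := S_rib hS
  have hε1 : ε (rib p) = 1 := eps_rib p ε hε
  have hu : drinfeldU p S = rib p * gg p := by rw [drinfeldU_sum, u_eq hS, gg]
  have hsq : rib p ^ 2 = drinfeldU p S * S (drinfeldU p S) := by
    rw [hu, S_mul hS, hSr, gg, S_kz hS, mul_assoc, ← mul_assoc (kz p _), kz_cancel, one_mul,
      pow_two]
  obtain ⟨Ri, h1, h2⟩ : ∃ Ri, Rmat p * Ri = 1 ∧ Ri * Rmat p = 1 := by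
    refine ⟨∑ i, al p i ⊗ₜ[ℂ] Si S (be p i), ?_, ?_⟩
    · rw [Rmat_sum]; exact R_Ri hS hΔ hε
    · rw [Rmat_sum]; exact Ri_R hS hΔ hε
  have hone : TensorProduct.comm ℂ (Dq p) (Dq p) 1 = 1 := rfl
  have h3 : R21 p * TensorProduct.comm ℂ (Dq p) (Dq p) Ri = 1 := by
    rw [R21, ← comm_mul', h1, hone]
  have h4 : TensorProduct.comm ℂ (Dq p) (Dq p) Ri * R21 p = 1 := by
    rw [R21, ← comm_mul', h2, hone]
  have hM1 : Mmat p * (Ri * TensorProduct.comm ℂ (Dq p) (Dq p) Ri) = 1 := by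
    rw [Mmat, mul_assoc, ← mul_assoc (Rmat p), h1, one_mul, h3]
  have hM2 : (Ri * TensorProduct.comm ℂ (Dq p) (Dq p) Ri) * Mmat p = 1 := by
    rw [Mmat, mul_assoc, ← mul_assoc _ (R21 p), h4, one_mul, h2]
  have hD := drinfeld_main (al p) (be p) Δ S (Si S) (S_mul hS) (Delta_S hS hΔ)
    (by rw [← Rmat_sum]; exact quasi_cocomm p Δ hΔ) (h2_D p Δ hΔ) (h3_D p Δ hΔ)
    (hb_D hS hΔ hε) (hu_D hS) (Ri_R hS hΔ hε)
  rw [← Rmat_sum, ← R21_sum, ← drinfeldU_sum, ← Mmat, hu] at hD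
  have hr : rib p = rib p * gg p * gi p := by rw [mul_assoc, gg_gi, mul_one]
  have hMr : Mmat p * Δ (rib p) = rib p ⊗ₜ[ℂ] rib p := by
    conv_lhs => rw [hr, map_mul Δ, ← mul_assoc, hD, gi, Delta_kz p Δ hΔ, ← gi]
    rw [Algebra.TensorProduct.tmul_mul_tmul, ← hr]
  set Minv := Ri * TensorProduct.comm ℂ (Dq p) (Dq p) Ri with hMi
  have hΔr : Δ (rib p) = Minv * (rib p ⊗ₜ[ℂ] rib p) := by
    rw [← hMr, ← mul_assoc, hM2, one_mul]
  have hT : ∀ w, T0 S (w * (rib p ⊗ₜ[ℂ] rib p)) = rib p * T0 S w * rib p := by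
    intro w
    induction w using TensorProduct.induction_on with
    | zero => rw [zero_mul, map_zero, mul_zero, zero_mul]
    | tmul a b =>
      rw [Algebra.TensorProduct.tmul_mul_tmul, T0_tmul, T0_tmul, S_mul hS, hSr]
      simp only [mul_assoc]
    | add u v hu hv => rw [add_mul, map_add, hu, hv, map_add, mul_add, add_mul]
  have h5 : rib p * T0 S Minv * rib p = 1 := by
    have h6 := T0_Delta hS hΔ hε (rib p) 1
    rw [mul_one, hΔr, hT, hε1, one_smul, Algebra.TensorProduct.one_def, T0_tmul, hS.1,
      mul_one] at h6
    exact h6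
  have hU : IsUnit (rib p) := by
    refine ⟨⟨rib p, T0 S Minv * rib p, ?_, ?_⟩, rfl⟩
    · rw [← mul_assoc, h5]
    · rw [← hc, ← mul_assoc, h5]
  exact ⟨hU, hc, hsq, hSr, hε1, Minv, hM1, hM2, hΔr⟩

end Final
end LogHennings

open LogHennings in
/-- `r` is a ribbon element for `(D, R)`. -/
theorem rib_is_ribbon (p : ℕ) (hp : 2 ≤ p) :
    ∀ (Δ : Dq p →ₐ[ℂ] Dq p ⊗[ℂ] Dq p) (ε : Dq p →ₐ[ℂ] ℂ)
        (S : Dq p →ₗ[ℂ] Dq p),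
      IsDeltaD p Δ → IsCounitD p ε → IsAntipodeD p S →
      IsUnit (rib p) ∧ (∀ x : Dq p, rib p * x = x * rib p) ∧
      rib p ^ 2 = drinfeldU p S * S (drinfeldU p S) ∧
      S (rib p) = rib p ∧ ε (rib p) = 1 ∧
      ∃ Minv : Dq p ⊗[ℂ] Dq p, Mmat p * Minv = 1 ∧ Minv * Mmat p = 1 ∧
        Δ (rib p) = Minv * (rib p ⊗ₜ[ℂ] rib p) := by
  haveI : Fact (2 ≤ p) := ⟨hp⟩
  intro Δ ε S hΔ hε hS
  exact ribbon_main Δ ε S hΔ hε hS
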